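/- arXiv:1803.09688 — 7 statements merged into one kernel-verified Lean document; each statement's English description precedes it below -/
import Mathlib

section
/- Let (Ω, F, (F_s)_{s≥0}, P) be a filtered probability space, t > 0, let M = (M_s)_{0≤s≤t} be a martingale with respect to (F_s) such that (s,ω) ↦ M_s(ω) is jointly measurable, and let Z = (Z_s)_{0≤s≤t} be a bounded, measurable, real-valued process adapted to (F_s). Then E[ M_t e^{∫_0^t Z_s ds} − ∫_0^t M_s Z_s e^{∫_0^s Z_r dr} ds ] = E[ M_0 ]. -/
open MeasureTheory

theorem abs_intervalIntegral_le_of_abs_le {f : ℝ → ℝ} {C : ℝ} (hbdd : ∀ x, |f x| ≤ C) (a b : ℝ) :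
    |∫ x in a..b, f x| ≤ C * |b - a| :=
  intervalIntegral.norm_integral_le_of_norm_le_const (f := f) fun x _ => hbdd x

theorem intervalIntegrable_of_abs_le {f : ℝ → ℝ} (hf : Measurable f) {C : ℝ}
    (hbdd : ∀ x, |f x| ≤ C) (a b : ℝ) : IntervalIntegrable f volume a b :=
  (intervalIntegrable_const (c := C)).mono_fun hf.aestronglyMeasurable
    (.of_forall fun x => (hbdd x).trans (le_abs_self C))

/-- The fundamental theorem of calculus for the exponential of the primitive of a bounded
measurable function. -/
theorem integral_mul_exp_primitive {f : ℝ → ℝ} (hf : Measurable f) {C : ℝ}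
    (hbdd : ∀ x, |f x| ≤ C) (a b : ℝ) :
    ∫ s in a..b, f s * Real.exp (∫ r in a..s, f r) = Real.exp (∫ r in a..b, f r) - 1 := by
  have hii := intervalIntegrable_of_abs_le hf hbdd
  have hC : 0 ≤ C := (abs_nonneg _).trans (hbdd 0)
  set F : ℝ → ℝ := fun s => ∫ r in a..s, f r with hF
  have hFlip : LipschitzOnWith C.toNNReal F (Set.uIcc a b) := by
    refine LipschitzOnWith.of_dist_le_mul fun x _ y _ => ?_
    rw [Real.dist_eq, Real.dist_eq, Real.coe_toNNReal C hC, hF]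
    simp only [intervalIntegral.integral_interval_sub_left (hii a x) (hii a y)]
    exact abs_intervalIntegral_le_of_abs_le hbdd y x
  have hmaps : Set.MapsTo F (Set.uIcc a b) (Set.Iic (C * |b - a|)) := fun x hx =>
    (le_abs_self _).trans <| (abs_intervalIntegral_le_of_abs_le hbdd a x).trans <|
      mul_le_mul_of_nonneg_left (Set.abs_sub_left_of_mem_uIcc hx) hC
  have hexp : LipschitzOnWith (Real.exp (C * |b - a|)).toNNReal Real.exp
      (Set.Iic (C * |b - a|)) := by
    refine (convex_Iic _).lipschitzOnWith_of_nnnorm_deriv_le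
      (fun x _ => Real.differentiableAt_exp) fun x hx => ?_
    rw [← NNReal.coe_le_coe, Real.coe_toNNReal _ (Real.exp_pos _).le, coe_nnnorm, Real.deriv_exp,
      Real.norm_eq_abs, Real.abs_exp]
    exact Real.exp_le_exp.2 hx
  have hftc := (hexp.comp hFlip hmaps).absolutelyContinuousOnInterval.integral_deriv_eq_sub
  simp only [Function.comp_apply, hF, intervalIntegral.integral_same, Real.exp_zero] at hftc
  rw [← hftc]
  refine intervalIntegral.integral_congr_ae ?_
  filter_upwards [(hii a b).ae_hasDerivAt_integral] with x hx hxab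
  have hd := (hx (Set.uIoc_subset_uIcc hxab) a Set.left_mem_uIcc).exp
  rw [mul_comm]
  exact hd.deriv.symm

section
variable {Ω : Type*} {m m0 : MeasurableSpace Ω} {μ : Measure Ω}

theorem measurable_intervalIntegral_uncurry {Z : ℝ → Ω → ℝ}
    (hZ : Measurable (Function.uncurry Z)) (a : ℝ) :
    Measurable fun p : ℝ × Ω => ∫ r in a..p.1, Z r p.2 := by
  have key : ∀ S : Set ((ℝ × Ω) × ℝ), MeasurableSet S →
      Measurable fun p : ℝ × Ω => ∫ r, S.indicator (fun q => Z q.2 q.1.2) (p, r) := by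
    intro S hS
    have h : Measurable fun q : (ℝ × Ω) × ℝ => Z q.2 q.1.2 :=
      hZ.comp (measurable_snd.prodMk (measurable_snd.comp measurable_fst))
    exact (h.indicator hS).stronglyMeasurable.integral_prod_right'.measurable
  have h1 : MeasurableSet {q : (ℝ × Ω) × ℝ | a < q.2 ∧ q.2 ≤ q.1.1} :=
    (measurableSet_lt measurable_const measurable_snd).inter
      (measurableSet_le measurable_snd (measurable_fst.comp measurable_fst))
  have h2 : MeasurableSet {q : (ℝ × Ω) × ℝ | q.1.1 < q.2 ∧ q.2 ≤ a} :=
    (measurableSet_lt (measurable_fst.comp measurable_fst) measurable_snd).inter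
      (measurableSet_le measurable_snd measurable_const)
  convert (key _ h1).sub (key _ h2) using 2 with p
  rw [intervalIntegral, ← integral_indicator measurableSet_Ioc,
    ← integral_indicator measurableSet_Ioc]
  rfl

theorem integral_mul_condExp_of_bound (hm : m ≤ m0) [IsFiniteMeasure μ] {X Y : Ω → ℝ}
    (hX : AEStronglyMeasurable[m] X μ) (hY : Integrable Y μ) {c : ℝ}
    (hc : ∀ᵐ ω ∂μ, |X ω| ≤ c) :
    ∫ ω, X ω * (μ[Y | m]) ω ∂μ = ∫ ω, X ω * Y ω ∂μ := by
  rw [← integral_condExp hm (f := fun ω => X ω * Y ω)]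
  exact integral_congr_ae (condExp_stronglyMeasurable_mul_of_bound₀ hm hX hY c hc).symm

/-- The time integral of a bounded jointly measurable process, each of whose values is measurable
with respect to a sub-σ-algebra, is almost everywhere measurable with respect to it. No
progressive measurability is required. -/
theorem aestronglyMeasurable_intervalIntegral (hm : m ≤ m0) [IsFiniteMeasure μ] {Z : ℝ → Ω → ℝ}
    (hZ : Measurable (Function.uncurry Z)) {C : ℝ} (hbdd : ∀ s ω, |Z s ω| ≤ C) {a b : ℝ}
    (hab : a ≤ b) (hZm : ∀ s ∈ Set.Ioc a b, Measurable[m] (Z s)) :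
    AEStronglyMeasurable[m] (fun ω => ∫ s in a..b, Z s ω) μ := by
  set A : Ω → ℝ := fun ω => ∫ s in a..b, Z s ω with hA
  have hAmeas : Measurable A :=
    (measurable_intervalIntegral_uncurry hZ a).comp (measurable_const.prodMk measurable_id)
  set R : ℝ := C * |b - a|
  have hAbdd : ∀ ω, |A ω| ≤ R := fun ω =>
    abs_intervalIntegral_le_of_abs_le (fun s => hbdd s ω) a b
  have hAint : Integrable A μ :=
    .of_bound hAmeas.aestronglyMeasurable _ (.of_forall hAbdd)
  set g : Ω → ℝ := μ[A | m]
  have hgm : StronglyMeasurable[m] g := stronglyMeasurable_condExp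
  have hgR : ∀ᵐ ω ∂μ, |g ω| ≤ R := ae_bdd_abs_condExp_of_ae_bdd_abs (.of_forall hAbdd)
  set D : Ω → ℝ := fun ω => A ω - g ω
  have hDint : Integrable D μ := hAint.sub integrable_condExp
  have hDcond : μ[D | m] =ᵐ[μ] 0 := by
    refine (condExp_sub hAint integrable_condExp m).trans ?_
    rw [condExp_of_stronglyMeasurable hm hgm integrable_condExp, sub_self]
  have horth : ∀ X : Ω → ℝ, StronglyMeasurable[m] X → ∀ c : ℝ, (∀ᵐ ω ∂μ, |X ω| ≤ c) →
      ∫ ω, X ω * D ω ∂μ = 0 := by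
    intro X hX c hc
    rw [← integral_mul_condExp_of_bound hm hX.aestronglyMeasurable hDint hc]
    refine integral_eq_zero_of_ae ?_
    filter_upwards [hDcond] with ω hω
    simp [hω]
  have hZD : Integrable (Function.uncurry fun s ω => Z s ω * D ω)
      ((volume.restrict (Set.Ioc a b)).prod μ) :=
    (hDint.comp_snd _).bdd_mul hZ.aestronglyMeasurable (.of_forall fun p => hbdd p.1 p.2)
  have hAD : ∫ ω, A ω * D ω ∂μ = 0 := by
    simp_rw [hA, intervalIntegral.integral_of_le hab, ← integral_mul_const]
    rw [← integral_integral_swap hZD]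
    refine setIntegral_eq_zero_of_forall_eq_zero fun s hs => ?_
    exact horth _ (hZm s hs).stronglyMeasurable C (.of_forall (hbdd s))
  have hD2 : ∫ ω, D ω * D ω ∂μ = 0 := by
    have : ∀ ω, D ω * D ω = A ω * D ω - g ω * D ω := fun ω => (sub_mul _ _ _)
    simp_rw [this]
    rw [integral_sub, hAD, horth g hgm R hgR, sub_zero]
    · exact hDint.bdd_mul hAmeas.aestronglyMeasurable (.of_forall hAbdd)
    · exact hDint.bdd_mul (hgm.mono hm).aestronglyMeasurable hgR
  have hDD : Integrable (fun ω => D ω * D ω) μ := by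
    refine hDint.bdd_mul (c := R + R) hDint.aestronglyMeasurable ?_
    filter_upwards [hgR] with ω hω
    exact (abs_sub _ _).trans (add_le_add (hAbdd ω) hω)
  rw [integral_eq_zero_iff_of_nonneg (fun ω => mul_self_nonneg _) hDD] at hD2
  refine ⟨g, hgm, ?_⟩
  filter_upwards [hD2] with ω hω
  exact sub_eq_zero.1 (mul_self_eq_zero.1 hω)

end

/-- If `M` is a martingale on `[0,t]` with respect to `ℱ`, jointly
measurable, and `Z` is a bounded measurable adapted real-valued process, then
`E[ M_t e^{∫_0^t Z_s ds} - ∫_0^t M_s Z_s e^{∫_0^s Z_r dr} ds ] = E[M_0]`. -/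
theorem expectation_martingale_exponential
    {Ω : Type*} {m0 : MeasurableSpace Ω} (μ : Measure Ω) [IsProbabilityMeasure μ]
    (ℱ : Filtration ℝ m0) (t : ℝ) (ht : 0 < t)
    (M : ℝ → Ω → ℝ)
    (hMjm : Measurable (Function.uncurry M))
    (hMadapted : ∀ s ∈ Set.Icc (0:ℝ) t, StronglyMeasurable[ℱ s] (M s))
    (hMint : ∀ s ∈ Set.Icc (0:ℝ) t, Integrable (M s) μ)
    (hMmart : ∀ s₁ ∈ Set.Icc (0:ℝ) t, ∀ s₂ ∈ Set.Icc (0:ℝ) t, s₁ ≤ s₂ →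
      μ[M s₂ | ℱ s₁] =ᵐ[μ] M s₁)
    (Z : ℝ → Ω → ℝ)
    (hZmeas : Measurable (Function.uncurry Z))
    (C : ℝ) (hZbdd : ∀ s ω, |Z s ω| ≤ C)
    (hZadapted : ∀ s : ℝ, Measurable[ℱ s] (Z s)) :
    ∫ ω, (M t ω * Real.exp (∫ s in (0:ℝ)..t, Z s ω) -
        ∫ s in (0:ℝ)..t, M s ω * Z s ω * Real.exp (∫ r in (0:ℝ)..s, Z r ω)) ∂μ =
      ∫ ω, M 0 ω ∂μ := by
  set I : ℝ → Ω → ℝ := fun s ω => ∫ r in (0:ℝ)..s, Z r ω with hI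
  set G : ℝ → Ω → ℝ := fun s ω => Z s ω * Real.exp (I s ω) with hG
  have ht0 : t ∈ Set.Icc (0 : ℝ) t := ⟨ht.le, le_rfl⟩
  have hImeas : Measurable (Function.uncurry I) := measurable_intervalIntegral_uncurry hZmeas 0
  have hGmeas : Measurable (Function.uncurry G) := hZmeas.mul hImeas.exp
  have hIbdd : ∀ s ∈ Set.Icc (0 : ℝ) t, ∀ ω, |I s ω| ≤ C * t := by
    intro s hs ω
    refine (abs_intervalIntegral_le_of_abs_le (fun r => hZbdd r ω) 0 s).trans ?_
    rw [sub_zero, abs_of_nonneg hs.1]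
    exact mul_le_mul_of_nonneg_left hs.2 ((abs_nonneg _).trans (hZbdd 0 ω))
  have hexpbdd : ∀ s ∈ Set.Icc (0 : ℝ) t, ∀ ω, |Real.exp (I s ω)| ≤ Real.exp (C * t) := by
    intro s hs ω
    rw [Real.abs_exp]
    exact Real.exp_le_exp.2 ((le_abs_self _).trans (hIbdd s hs ω))
  have hGbdd : ∀ s ∈ Set.Icc (0 : ℝ) t, ∀ ω, |G s ω| ≤ C * Real.exp (C * t) := by
    intro s hs ω
    rw [hG, abs_mul]
    exact mul_le_mul (hZbdd s ω) (hexpbdd s hs ω) (abs_nonneg _)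
      ((abs_nonneg _).trans (hZbdd s ω))
  have hGad : ∀ s ∈ Set.Icc (0 : ℝ) t, AEStronglyMeasurable[ℱ s] (G s) μ := by
    intro s hs
    refine (hZadapted s).stronglyMeasurable.aestronglyMeasurable.mul ?_
    exact Real.continuous_exp.comp_aestronglyMeasurable
      (aestronglyMeasurable_intervalIntegral (ℱ.le s) hZmeas hZbdd hs.1
        fun r hr => (hZadapted r).mono (ℱ.mono hr.2) le_rfl)
  have hswap : ∀ s ∈ Set.Icc (0 : ℝ) t,
      ∫ ω, G s ω * M s ω ∂μ = ∫ ω, G s ω * M t ω ∂μ := by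
    intro s hs
    rw [← integral_mul_condExp_of_bound (ℱ.le s) (hGad s hs) (hMint t ht0)
      (.of_forall (hGbdd s hs))]
    refine integral_congr_ae ?_
    filter_upwards [hMmart s hs t ht0 hs.2] with ω hω
    rw [hω]
  set ν : Measure ℝ := volume.restrict (Set.Ioc 0 t) with hν
  have hνmem : ∀ᵐ s ∂ν, s ∈ Set.Icc (0 : ℝ) t :=
    (ae_restrict_mem measurableSet_Ioc).mono fun s hs => Set.Ioc_subset_Icc_self hs
  have hMprod : Integrable (Function.uncurry M) (ν.prod μ) := by
    rw [integrable_prod_iff hMjm.aestronglyMeasurable]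
    refine ⟨hνmem.mono fun s hs => hMint s hs, ?_⟩
    refine .of_bound (C := ∫ ω, |M t ω| ∂μ)
      hMjm.stronglyMeasurable.norm.integral_prod_right'.aestronglyMeasurable
      (hνmem.mono fun s hs => ?_)
    rw [Real.norm_of_nonneg (integral_nonneg fun _ => norm_nonneg _)]
    calc ∫ ω, ‖M s ω‖ ∂μ = ∫ ω, |(μ[M t | ℱ s]) ω| ∂μ := by
          refine integral_congr_ae ?_
          filter_upwards [hMmart s hs t ht0 hs.2] with ω hω
          rw [hω, Real.norm_eq_abs]
      _ ≤ ∫ ω, |M t ω| ∂μ := integral_abs_condExp_le _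
  have hGbdd' : ∀ᵐ p ∂ν.prod μ, ‖Function.uncurry G p‖ ≤ C * Real.exp (C * t) :=
    (Measure.quasiMeasurePreserving_fst.ae hνmem).mono fun p hp => hGbdd p.1 hp p.2
  have hGM : Integrable (Function.uncurry fun s ω => G s ω * M s ω) (ν.prod μ) :=
    hMprod.bdd_mul hGmeas.aestronglyMeasurable hGbdd'
  have hGMt : Integrable (Function.uncurry fun s ω => G s ω * M t ω) (ν.prod μ) :=
    ((hMint t ht0).comp_snd ν).bdd_mul hGmeas.aestronglyMeasurable hGbdd'
  have hpath : ∀ ω, ∫ s in (0:ℝ)..t, M s ω * Z s ω * Real.exp (I s ω) =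
      ∫ s, G s ω * M s ω ∂ν := by
    intro ω
    rw [intervalIntegral.integral_of_le ht.le]
    exact integral_congr_ae (.of_forall fun s => by simp only [hG]; ring)
  have hftc : ∀ ω, ∫ s, G s ω * M t ω ∂ν = Real.exp (I t ω) * M t ω - M t ω := by
    intro ω
    rw [integral_mul_const, hν, ← intervalIntegral.integral_of_le ht.le]
    simp only [hG, hI]
    rw [integral_mul_exp_primitive (f := fun s => Z s ω) (hZmeas.comp measurable_prodMk_right)
      (fun s => hZbdd s ω)]
    ring
  have hexpM : Integrable (fun ω => Real.exp (I t ω) * M t ω) μ :=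
    (hMint t ht0).bdd_mul
      (hImeas.comp measurable_prodMk_left).exp.aestronglyMeasurable
      (.of_forall (hexpbdd t ht0))
  have hM0 : ∫ ω, M t ω ∂μ = ∫ ω, M 0 ω ∂μ := by
    rw [← integral_condExp (ℱ.le 0) (f := M t)]
    exact integral_congr_ae (hMmart 0 ⟨le_rfl, ht.le⟩ t ht0 ht.le)
  calc ∫ ω, (M t ω * Real.exp (I t ω) -
        ∫ s in (0:ℝ)..t, M s ω * Z s ω * Real.exp (I s ω)) ∂μ
      = ∫ ω, (Real.exp (I t ω) * M t ω - ∫ s, G s ω * M s ω ∂ν) ∂μ := by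
        simp_rw [hpath, mul_comm (M t _)]
    _ = ∫ ω, Real.exp (I t ω) * M t ω ∂μ - ∫ ω, ∫ s, G s ω * M s ω ∂ν ∂μ :=
        integral_sub hexpM hGM.integral_prod_right
    _ = ∫ ω, Real.exp (I t ω) * M t ω ∂μ - ∫ ω, ∫ s, G s ω * M t ω ∂ν ∂μ := by
        rw [← integral_integral_swap hGM, ← integral_integral_swap hGMt]
        congr 1
        exact integral_congr_ae (hνmem.mono hswap)
    _ = ∫ ω, M 0 ω ∂μ := by
        simp_rw [hftc]
        rw [integral_sub hexpM (hMint t ht0), hM0]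
        ring
end

section
/- Suppose f : ℝ → ℝ satisfies f(0) ≥ 0, f(1) = 0, and f is Lipschitz on [0,1]. Then for every measurable u_0 : E → [0,1] there exists a mild solution u of ∂u/∂t = 𝓛u + f(u) with initial condition u_0 such that u(t,x) ∈ [0,1] for all (t,x) ∈ [0,∞) × E. -/
open MeasureTheory ProbabilityTheory

/-- A mild solution of `∂u/∂t = 𝓛u + f(u)` with initial condition `u₀`, where `𝓛`
generates the Markov semigroup of kernels `P`. -/
def IsMildSolution {E : Type*} [MeasurableSpace E] (P : ℝ → Kernel E E)
    (f : ℝ → ℝ) (u₀ : E → ℝ) (u : ℝ → E → ℝ) : Prop :=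
  Measurable (Function.uncurry u) ∧ (∀ x, u 0 x = u₀ x) ∧
    ∀ t ≥ (0:ℝ), ∀ x, u t x = (∫ y, u₀ y ∂(P t x)) +
      ∫ s in (0:ℝ)..t, ∫ y, f (u (t - s) y) ∂(P s x)

namespace MildSolution

open Set Filter Topology

variable {E : Type*} [MeasurableSpace E]

lemma integrable_of_mem_Icc {α : Type*} [MeasurableSpace α] {μ : Measure α} [IsFiniteMeasure μ]
    {φ : α → ℝ} (hφ : Measurable φ) {a b : ℝ} (h : ∀ y, φ y ∈ Icc a b) : Integrable φ μ :=
  Integrable.of_mem_Icc a b hφ.aemeasurable (Eventually.of_forall h)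

lemma integral_mem_Icc {α : Type*} [MeasurableSpace α] {μ : Measure α} [IsProbabilityMeasure μ]
    {φ : α → ℝ} (hφ : Measurable φ) {a b : ℝ} (h : ∀ y, φ y ∈ Icc a b) :
    ∫ y, φ y ∂μ ∈ Icc a b := by
  have hi : Integrable φ μ := integrable_of_mem_Icc hφ h
  constructor
  · simpa using integral_mono (integrable_const a) hi fun y => (h y).1
  · simpa using integral_mono hi (integrable_const b) fun y => (h y).2

lemma intervalIntegrable_of_mem_Icc {φ : ℝ → ℝ} (hφ : Measurable φ) {a b : ℝ}
    (h : ∀ s, φ s ∈ Icc a b) (c d : ℝ) : IntervalIntegrable φ volume c d :=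
  ⟨integrable_of_mem_Icc hφ h, integrable_of_mem_Icc hφ h⟩

lemma measurable_intervalIntegral {α : Type*} [MeasurableSpace α] {F : α → ℝ → ℝ}
    (hF : Measurable (Function.uncurry F)) {τ : α → ℝ} (hτ : Measurable τ) (hτ0 : ∀ a, 0 ≤ τ a) :
    Measurable fun a => ∫ s in (0 : ℝ)..τ a, F a s := by
  have hS : MeasurableSet {p : α × ℝ | 0 < p.2 ∧ p.2 ≤ τ p.1} :=
    (measurableSet_lt measurable_const measurable_snd).inter
      (measurableSet_le measurable_snd (hτ.comp measurable_fst))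
  have h := (hF.indicator hS).stronglyMeasurable.integral_prod_right' (ν := volume)
  convert h.measurable using 2 with a
  rw [intervalIntegral.integral_of_le (hτ0 a), ← integral_indicator measurableSet_Ioc]
  rfl

/-- The joint kernel on `ℝ × E` of a measurable family of Markov kernels. -/
noncomputable def jointKernel (P : ℝ → Kernel E E) [∀ t, IsMarkovKernel (P t)]
    (hP : ∀ g : E → ℝ, Measurable g → (∃ C, ∀ x, |g x| ≤ C) →
      Measurable (fun p : ℝ × E => ∫ y, g y ∂(P p.1 p.2))) : Kernel (ℝ × E) E where
  toFun p := P p.1 p.2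
  measurable' := by
    refine Measure.measurable_of_measurable_coe _ fun s hs => ?_
    have h := hP (s.indicator 1) (measurable_one.indicator hs)
      ⟨1, fun x => by by_cases hx : x ∈ s <;> simp [hx]⟩
    convert h.ennreal_ofReal using 2 with p
    rw [integral_indicator_one hs, ofReal_measureReal]

instance (P : ℝ → Kernel E E) [∀ t, IsMarkovKernel (P t)]
    (hP : ∀ g : E → ℝ, Measurable g → (∃ C, ∀ x, |g x| ≤ C) →
      Measurable (fun p : ℝ × E => ∫ y, g y ∂(P p.1 p.2))) : IsMarkovKernel (jointKernel P hP) :=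
  ⟨fun p => inferInstanceAs (IsProbabilityMeasure (P p.1 p.2))⟩

section Picard

variable (κ : Kernel (ℝ × E) E) [IsMarkovKernel κ] (L : ℝ) (g : ℝ → ℝ) (u₀ : E → ℝ)

/-- The exponentially discounted Duhamel map, extended to negative times by its value at `0`. -/
noncomputable def duhamel (u : ℝ → E → ℝ) (t : ℝ) (x : E) : ℝ :=
  Real.exp (-L * max t 0) * (∫ y, u₀ y ∂κ (max t 0, x)) +
    ∫ s in (0 : ℝ)..max t 0, Real.exp (-L * s) * ∫ y, g (u (max t 0 - s) y) ∂κ (s, x)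

variable {κ L g u₀}

lemma measurable_integral_kernel {α : Type*} [MeasurableSpace α] {v : α → E → ℝ}
    (hv : Measurable (Function.uncurry v)) {k : α → ℝ × E} (hk : Measurable k) :
    Measurable fun a => ∫ y, v a y ∂κ (k a) :=
  (hv.stronglyMeasurable.integral_kernel_prod_right' (κ := κ.comap k hk)).measurable

lemma measurable_discounted_integrand (hg : Measurable g) {u : ℝ → E → ℝ}
    (hu : Measurable (Function.uncurry u)) :
    Measurable (Function.uncurry fun (p : ℝ × E) (s : ℝ) =>
      Real.exp (-L * s) * ∫ y, g (u (max p.1 0 - s) y) ∂κ (s, p.2)) := by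
  refine Measurable.mul (by fun_prop) ?_
  refine measurable_integral_kernel (v := fun (q : (ℝ × E) × ℝ) y => g (u (max q.1.1 0 - q.2) y))
    (k := fun q => (q.2, q.1.2)) ?_ (by fun_prop)
  exact hg.comp (hu.comp (f := fun r : ((ℝ × E) × ℝ) × E => (max r.1.1.1 0 - r.1.2, r.2))
    (by fun_prop))

lemma measurable_duhamel (hg : Measurable g) (hu₀ : Measurable u₀) {u : ℝ → E → ℝ}
    (hu : Measurable (Function.uncurry u)) :
    Measurable (Function.uncurry (duhamel κ L g u₀ u)) := by
  refine Measurable.add (Measurable.mul (by fun_prop) ?_) ?_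
  · exact measurable_integral_kernel (v := fun (_ : ℝ × E) y => u₀ y)
      (k := fun p => (max p.1 0, p.2)) (hu₀.comp measurable_snd) (by fun_prop)
  · exact measurable_intervalIntegral (measurable_discounted_integrand hg hu) (by fun_prop)
      fun _ => le_max_right _ _

lemma intervalIntegral_exp_neg_mul (L a b : ℝ) :
    ∫ s in a..b, L * Real.exp (-L * s) = Real.exp (-L * a) - Real.exp (-L * b) := by
  have h : ∀ s ∈ uIcc a b, HasDerivAt (fun s => -Real.exp (-L * s)) (L * Real.exp (-L * s)) s := by
    intro s _
    refine (((hasDerivAt_id s).const_mul (-L)).exp).neg.congr_deriv ?_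
    simp only [id]
    ring
  rw [intervalIntegral.integral_eq_sub_of_hasDerivAt h
    (Continuous.intervalIntegrable (by fun_prop) _ _)]
  ring

lemma measurable_path {v : ℝ → E → ℝ} (hv : Measurable (Function.uncurry v)) (τ : ℝ) (x : E) :
    Measurable fun s => ∫ y, v (τ - s) y ∂κ (s, x) :=
  measurable_integral_kernel (v := fun s y => v (τ - s) y) (k := fun s => (s, x))
    (hv.comp (f := fun r : ℝ × E => (τ - r.1, r.2)) (by fun_prop)) (by fun_prop)

lemma intervalIntegrable_exp_mul {h : ℝ → ℝ} (hh : Measurable h) {a b : ℝ}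
    (hab : ∀ s, h s ∈ Icc a b) (c d : ℝ) :
    IntervalIntegrable (fun s => Real.exp (-L * s) * h s) volume c d :=
  (intervalIntegrable_of_mem_Icc hh hab c d).continuousOn_mul (by fun_prop)

lemma duhamel_mem_Icc (hgm : Measurable g) (hg : ∀ r, g r ∈ Icc 0 L)
    (hu₀ : Measurable u₀) (hu₀' : ∀ x, u₀ x ∈ Icc (0 : ℝ) 1) {u : ℝ → E → ℝ}
    (hu : Measurable (Function.uncurry u)) (t : ℝ) (x : E) :
    duhamel κ L g u₀ u t x ∈ Icc (0 : ℝ) 1 := by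
  have hτ : 0 ≤ max t 0 := le_max_right _ _
  unfold duhamel
  generalize max t 0 = τ at hτ
  have h0 := integral_mem_Icc (μ := κ (τ, x)) hu₀ hu₀'
  have hm := measurable_path (κ := κ) (v := fun r y => g (u r y)) (hgm.comp hu) τ x
  have hh : ∀ s, ∫ y, g (u (τ - s) y) ∂κ (s, x) ∈ Icc 0 L := fun s =>
    integral_mem_Icc (hgm.comp (hu.comp measurable_prodMk_left)) fun _ => hg _
  have hi := intervalIntegrable_exp_mul (L := L) hm hh 0 τ
  constructor
  · refine add_nonneg (mul_nonneg (Real.exp_nonneg _) h0.1) ?_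
    exact intervalIntegral.integral_nonneg hτ fun s _ => mul_nonneg (Real.exp_nonneg _) (hh s).1
  · have h1 := intervalIntegral.integral_mono_on (g := fun s => L * Real.exp (-L * s)) hτ hi
      (Continuous.intervalIntegrable (by fun_prop) _ _)
      fun s _ => by
        rw [mul_comm]
        exact mul_le_mul_of_nonneg_right (hh s).2 (Real.exp_nonneg _)
    rw [intervalIntegral_exp_neg_mul] at h1
    have h2 := mul_le_mul_of_nonneg_left h0.2 (Real.exp_nonneg (-L * τ))
    simp only [mul_zero, Real.exp_zero, mul_one] at h1 h2
    linarith

lemma duhamel_mono (hgm : Measurable g) (hg : ∀ r, g r ∈ Icc 0 L) (hmono : Monotone g)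
    {u v : ℝ → E → ℝ} (hu : Measurable (Function.uncurry u)) (hv : Measurable (Function.uncurry v))
    (huv : u ≤ v) : duhamel κ L g u₀ u ≤ duhamel κ L g u₀ v := by
  intro t x
  have hτ : 0 ≤ max t 0 := le_max_right _ _
  unfold duhamel
  generalize max t 0 = τ at hτ
  have hs : ∀ {w : ℝ → E → ℝ}, Measurable (Function.uncurry w) → ∀ s,
      Measurable fun y => g (w (τ - s) y) := fun hw s => hgm.comp (hw.comp measurable_prodMk_left)
  have hi : ∀ {w : ℝ → E → ℝ}, Measurable (Function.uncurry w) → IntervalIntegrable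
      (fun s => Real.exp (-L * s) * ∫ y, g (w (τ - s) y) ∂κ (s, x)) volume 0 τ := fun {w} hw =>
    intervalIntegrable_exp_mul (measurable_path (v := fun r y => g (w r y)) (hgm.comp hw) τ x)
      (fun s => integral_mem_Icc (hs hw s) fun _ => hg _) 0 τ
  gcongr
  refine intervalIntegral.integral_mono_on hτ (hi hu) (hi hv) fun s _ => ?_
  refine mul_le_mul_of_nonneg_left ?_ (Real.exp_nonneg _)
  exact integral_mono (integrable_of_mem_Icc (hs hu s) fun _ => hg _)
    (integrable_of_mem_Icc (hs hv s) fun _ => hg _) fun y => hmono (huv _ _)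

lemma tendsto_duhamel (hgc : Continuous g) (hg : ∀ r, g r ∈ Icc 0 L)
    {w : ℕ → ℝ → E → ℝ} (hw : ∀ n, Measurable (Function.uncurry (w n))) {u : ℝ → E → ℝ}
    (h : ∀ t x, Tendsto (fun n => w n t x) atTop (𝓝 (u t x))) (t : ℝ) (x : E) :
    Tendsto (fun n => duhamel κ L g u₀ (w n) t x) atTop (𝓝 (duhamel κ L g u₀ u t x)) := by
  have hτ : 0 ≤ max t 0 := le_max_right _ _
  unfold duhamel
  generalize max t 0 = τ at hτ
  have hs : ∀ n s, Measurable fun y => g (w n (τ - s) y) := fun n s =>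
    hgc.measurable.comp ((hw n).comp measurable_prodMk_left)
  have hb : ∀ r, ‖g r‖ ≤ L := fun r => by
    rw [Real.norm_of_nonneg (hg r).1]; exact (hg r).2
  refine tendsto_const_nhds.add ?_
  refine intervalIntegral.tendsto_integral_filter_of_dominated_convergence
    (fun s => Real.exp (-L * s) * L) ?_ ?_
    (Continuous.intervalIntegrable (by fun_prop) _ _) ?_
  · refine Eventually.of_forall fun n => Measurable.aestronglyMeasurable ?_
    exact Measurable.mul (by fun_prop)
      (measurable_path (v := fun r y => g (w n r y)) (hgc.measurable.comp (hw n)) τ x)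
  · refine Eventually.of_forall fun n => Eventually.of_forall fun s _ => ?_
    have := integral_mem_Icc (μ := κ (s, x)) (hs n s) fun _ => hg _
    rw [norm_mul, Real.norm_of_nonneg (Real.exp_nonneg _), Real.norm_of_nonneg this.1]
    exact mul_le_mul_of_nonneg_left this.2 (Real.exp_nonneg _)
  · refine Eventually.of_forall fun s _ => Tendsto.const_mul _ ?_
    refine tendsto_integral_of_dominated_convergence (fun _ => L)
      (fun n => (hs n s).aestronglyMeasurable) (integrable_const _)
      (fun n => Eventually.of_forall fun y => hb _) (Eventually.of_forall fun y => ?_)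
    exact (hgc.tendsto _).comp (h _ _)

lemma exists_duhamel_eq (hgc : Continuous g) (hg : ∀ r, g r ∈ Icc 0 L) (hmono : Monotone g)
    (hu₀ : Measurable u₀) (hu₀' : ∀ x, u₀ x ∈ Icc (0 : ℝ) 1) :
    ∃ u : ℝ → E → ℝ, Measurable (Function.uncurry u) ∧ (∀ t x, u t x ∈ Icc (0 : ℝ) 1) ∧
      duhamel κ L g u₀ u = u := by
  let w : ℕ → ℝ → E → ℝ := fun n => (duhamel κ L g u₀)^[n] 0
  have hsucc : ∀ n, w (n + 1) = duhamel κ L g u₀ (w n) := fun n =>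
    Function.iterate_succ_apply' _ _ _
  have hm : ∀ n, Measurable (Function.uncurry (w n)) := by
    intro n
    induction n with
    | zero => exact measurable_const
    | succ n ih => rw [hsucc]; exact measurable_duhamel hgc.measurable hu₀ ih
  have hmem : ∀ n t x, w n t x ∈ Icc (0 : ℝ) 1 := by
    intro n t x
    cases n with
    | zero => simp [w]
    | succ n => rw [hsucc]; exact duhamel_mem_Icc hgc.measurable hg hu₀ hu₀' (hm n) t x
  have hw : Monotone w := by
    refine monotone_nat_of_le_succ fun n => ?_
    induction n with
    | zero => exact fun t x => (hmem 1 t x).1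
    | succ n ih =>
      rw [hsucc n, hsucc (n + 1)]
      exact duhamel_mono hgc.measurable hg hmono (hm n) (hm (n + 1)) ih
  have hlim : ∀ t x, Tendsto (fun n => w n t x) atTop (𝓝 (⨆ n, w n t x)) := fun t x =>
    tendsto_atTop_ciSup (fun m n hmn => hw hmn t x)
      ⟨1, by rintro _ ⟨n, rfl⟩; exact (hmem n t x).2⟩
  refine ⟨fun t x => ⨆ n, w n t x, ?_, ?_, ?_⟩
  · exact measurable_of_tendsto_metrizable hm (tendsto_pi_nhds.2 fun p => hlim p.1 p.2)
  · exact fun t x => isClosed_Icc.mem_of_tendsto (hlim t x)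
      (Eventually.of_forall fun n => hmem n t x)
  · ext t x
    refine tendsto_nhds_unique (tendsto_duhamel hgc hg hm hlim t x) ?_
    simp_rw [← hsucc]
    exact (hlim t x).comp (tendsto_add_atTop_nat 1)

lemma intervalIntegral_ite_lt {a : ℝ → ℝ} {t s : ℝ} (hs : s ∈ Icc 0 t) :
    ∫ q in (0 : ℝ)..t, (if s < q then a q else 0) = ∫ q in s..t, a q := by
  rw [intervalIntegral.integral_of_le (hs.1.trans hs.2), intervalIntegral.integral_of_le hs.2,
    ← integral_indicator measurableSet_Ioc, ← integral_indicator measurableSet_Ioc]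
  congr 1
  ext q
  simp only [indicator, mem_Ioc]
  grind

lemma intervalIntegral_ite_gt {a : ℝ → ℝ} {t q : ℝ} (hq : q ∈ Icc 0 t) :
    ∫ s in (0 : ℝ)..t, (if s < q then a s else 0) = ∫ s in (0 : ℝ)..q, a s := by
  rw [intervalIntegral.integral_of_le (hq.1.trans hq.2), intervalIntegral.integral_of_le hq.1,
    integral_Ioc_eq_integral_Ioo, integral_Ioc_eq_integral_Ioo,
    ← integral_indicator measurableSet_Ioo, ← integral_indicator measurableSet_Ioo]
  congr 1
  ext s
  simp only [indicator, mem_Ioo]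
  grind

/-- Fubini's theorem on a triangle, for an exponential weight. -/
lemma integral_integral_exp_mul {h : ℝ → ℝ} (hh : Measurable h) (hL : 0 ≤ L) {C : ℝ}
    (hC : ∀ s, h s ∈ Icc 0 C) {t : ℝ} (ht : 0 ≤ t) :
    ∫ s in (0 : ℝ)..t, L * ∫ q in s..t, Real.exp (-L * (q - s)) * h q =
      ∫ q in (0 : ℝ)..t, (1 - Real.exp (-L * q)) * h q := by
  let F : ℝ → ℝ → ℝ := fun s q => if s < q then L * (Real.exp (-L * (q - s)) * h q) else 0
  have hFm : Measurable F.uncurry :=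
    Measurable.ite (measurableSet_lt measurable_fst measurable_snd) (by fun_prop) measurable_const
  have hF : ∀ p, F.uncurry p ∈ Icc 0 (L * C) := by
    rintro ⟨s, q⟩
    have hC0 : 0 ≤ C := (hC q).1.trans (hC q).2
    by_cases hsq : s < q
    · have he : Real.exp (-L * (q - s)) ≤ 1 := Real.exp_le_one_iff.2 (by nlinarith)
      simp only [Function.uncurry, F, if_pos hsq]
      refine ⟨mul_nonneg hL (mul_nonneg (Real.exp_nonneg _) (hC q).1), ?_⟩
      gcongr
      calc _ ≤ 1 * h q := mul_le_mul_of_nonneg_right he (hC q).1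
        _ ≤ C := by simpa using (hC q).2
    · simp only [Function.uncurry, F, if_neg hsq]
      exact ⟨le_rfl, by positivity⟩
  have hFi : IntegrableOn F.uncurry (uIoc 0 t ×ˢ uIoc 0 t) := by
    rw [IntegrableOn, Measure.volume_eq_prod, ← Measure.prod_restrict]
    have : IsFiniteMeasure (volume.restrict (uIoc 0 t)) := by
      rw [uIoc_of_le ht]; infer_instance
    exact integrable_of_mem_Icc hFm hF
  have h1 : ∀ s ∈ uIcc 0 t, L * ∫ q in s..t, Real.exp (-L * (q - s)) * h q =
      ∫ q in (0 : ℝ)..t, F s q := by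
    intro s hs
    rw [uIcc_of_le ht] at hs
    rw [intervalIntegral_ite_lt hs, intervalIntegral.integral_const_mul]
  have h2 : ∀ q ∈ uIcc 0 t, ∫ s in (0 : ℝ)..t, F s q = (1 - Real.exp (-L * q)) * h q := by
    intro q hq
    rw [uIcc_of_le ht] at hq
    rw [intervalIntegral_ite_gt (a := fun s => L * (Real.exp (-L * (q - s)) * h q)) hq]
    simp_rw [← mul_assoc]
    rw [intervalIntegral.integral_mul_const,
      intervalIntegral.integral_comp_sub_left (fun s => L * Real.exp (-L * s)) q,
      intervalIntegral_exp_neg_mul]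
    simp
  rw [intervalIntegral.integral_congr h1, intervalIntegral_intervalIntegral_swap hFi,
    intervalIntegral.integral_congr h2]

lemma integral_fixed_point (hgm : Measurable g) (hg : ∀ r, g r ∈ Icc 0 L)
    (hsemi : ∀ s ≥ (0 : ℝ), ∀ r ≥ (0 : ℝ), ∀ φ : E → ℝ, Measurable φ →
      (∀ a b, (∀ y, φ y ∈ Icc a b) → ∀ x,
        ∫ y, ∫ z, φ z ∂κ (r, y) ∂κ (s, x) = ∫ z, φ z ∂κ (s + r, x)))
    (hu₀ : Measurable u₀) (hu₀' : ∀ x, u₀ x ∈ Icc (0 : ℝ) 1) {u : ℝ → E → ℝ}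
    (hu : Measurable (Function.uncurry u)) (hfix : duhamel κ L g u₀ u = u)
    {t s : ℝ} (hs : s ∈ Icc 0 t) (x : E) :
    ∫ y, u (t - s) y ∂κ (s, x) = Real.exp (-L * (t - s)) * (∫ y, u₀ y ∂κ (t, x)) +
      ∫ q in s..t, Real.exp (-L * (q - s)) * ∫ y, g (u (t - q) y) ∂κ (q, x) := by
  have hts : 0 ≤ t - s := sub_nonneg.2 hs.2
  have hL : 0 ≤ L := (hg 0).1.trans (hg 0).2
  have hgs : ∀ r, Measurable fun y => g (u r y) := fun r =>
    hgm.comp (hu.comp measurable_prodMk_left)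
  let F : ℝ → E → ℝ := fun r y => Real.exp (-L * r) * ∫ z, g (u (t - s - r) z) ∂κ (r, y)
  have hFm : Measurable F.uncurry := by
    refine Measurable.mul (by fun_prop) ?_
    exact measurable_integral_kernel (v := fun (q : ℝ × E) z => g (u (t - s - q.1) z))
      (k := fun q => q) (hgm.comp
        (hu.comp (f := fun r : (ℝ × E) × E => (t - s - r.1.1, r.2)) (by fun_prop))) (by fun_prop)
  have hFi : Integrable F.uncurry ((volume.restrict (uIoc 0 (t - s))).prod (κ (s, x))) := by
    rw [uIoc_of_le hts]
    refine Integrable.of_bound hFm.aestronglyMeasurable L ?_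
    have hae : ∀ᵐ r ∂(volume.restrict (Ioc 0 (t - s))), 0 ≤ r :=
      (ae_restrict_mem measurableSet_Ioc).mono fun r hr => hr.1.le
    filter_upwards [Measure.quasiMeasurePreserving_fst.ae hae] with p hp
    have hb := integral_mem_Icc (μ := κ (p.1, p.2)) (hgs (t - s - p.1)) fun _ => hg _
    have he : Real.exp (-L * p.1) ≤ 1 := Real.exp_le_one_iff.2 (by nlinarith)
    rw [Function.uncurry, norm_mul, Real.norm_of_nonneg (Real.exp_nonneg _),
      Real.norm_of_nonneg hb.1]
    calc _ ≤ 1 * L := mul_le_mul he hb.2 hb.1 zero_le_one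
      _ = L := one_mul _
  have hu' : ∀ y, u (t - s) y = Real.exp (-L * (t - s)) * (∫ z, u₀ z ∂κ (t - s, y)) +
      ∫ r in (0 : ℝ)..(t - s), F r y := fun y => by
    conv_lhs => rw [← hfix]
    simp only [duhamel, max_eq_left hts, F]
  have hi₀ : Integrable (fun y => Real.exp (-L * (t - s)) * ∫ z, u₀ z ∂κ (t - s, y))
      (κ (s, x)) :=
    (integrable_of_mem_Icc (measurable_integral_kernel (v := fun (_ : E) z => u₀ z)
      (k := fun y => (t - s, y)) (hu₀.comp measurable_snd) (by fun_prop))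
      fun y => integral_mem_Icc hu₀ hu₀').const_mul _
  have hi₁ : Integrable (fun y => ∫ r in (0 : ℝ)..(t - s), F r y) (κ (s, x)) := by
    simp_rw [intervalIntegral.integral_of_le hts]
    rw [uIoc_of_le hts] at hFi
    exact hFi.integral_prod_right
  simp_rw [hu']
  rw [integral_add hi₀ hi₁, integral_const_mul,
    hsemi s hs.1 (t - s) hts u₀ hu₀ 0 1 hu₀' x, add_sub_cancel,
    ← intervalIntegral_integral_swap hFi]
  congr 1
  have hF' : ∀ r ∈ uIcc 0 (t - s), ∫ y, F r y ∂κ (s, x) =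
      Real.exp (-L * (s + r - s)) * ∫ z, g (u (t - (s + r)) z) ∂κ (s + r, x) := by
    intro r hr
    rw [uIcc_of_le hts] at hr
    rw [integral_const_mul, hsemi s hs.1 r hr.1 _ (hgs _) 0 L (fun _ => hg _) x, sub_sub,
      add_sub_cancel_left]
  rw [intervalIntegral.integral_congr hF', intervalIntegral.integral_comp_add_left
    (fun q => Real.exp (-L * (q - s)) * ∫ z, g (u (t - q) z) ∂κ (q, x)) s]
  simp

/-- A fixed point of the discounted Duhamel map solves the undiscounted equation. -/
lemma eq_of_duhamel_eq (hgm : Measurable g) (hg : ∀ r, g r ∈ Icc 0 L)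
    (hsemi : ∀ s ≥ (0 : ℝ), ∀ r ≥ (0 : ℝ), ∀ φ : E → ℝ, Measurable φ →
      (∀ a b, (∀ y, φ y ∈ Icc a b) → ∀ x,
        ∫ y, ∫ z, φ z ∂κ (r, y) ∂κ (s, x) = ∫ z, φ z ∂κ (s + r, x)))
    (hu₀ : Measurable u₀) (hu₀' : ∀ x, u₀ x ∈ Icc (0 : ℝ) 1) {u : ℝ → E → ℝ}
    (hu : Measurable (Function.uncurry u)) (hu' : ∀ t x, u t x ∈ Icc (0 : ℝ) 1)
    (hfix : duhamel κ L g u₀ u = u) {t : ℝ} (ht : 0 ≤ t) (x : E) :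
    u t x = (∫ y, u₀ y ∂κ (t, x)) +
      ∫ s in (0 : ℝ)..t, ∫ y, (g (u (t - s) y) - L * u (t - s) y) ∂κ (s, x) := by
  have hL : 0 ≤ L := (hg 0).1.trans (hg 0).2
  have hus : ∀ r, Measurable fun y => u r y := fun r => hu.comp measurable_prodMk_left
  have hgs : ∀ r, Measurable fun y => g (u r y) := fun r => hgm.comp (hus r)
  have hm : Measurable fun s => ∫ y, g (u (t - s) y) ∂κ (s, x) :=
    measurable_path (v := fun r y => g (u r y)) (hgm.comp hu) t x
  have hh : ∀ s, ∫ y, g (u (t - s) y) ∂κ (s, x) ∈ Icc 0 L := fun s =>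
    integral_mem_Icc (hgs _) fun _ => hg _
  have hmu : Measurable fun s => ∫ y, u (t - s) y ∂κ (s, x) := measurable_path hu t x
  have hhu : ∀ s, ∫ y, u (t - s) y ∂κ (s, x) ∈ Icc (0 : ℝ) 1 := fun s =>
    integral_mem_Icc (hus _) fun _ => hu' _ _
  have hut : u t x = Real.exp (-L * t) * (∫ y, u₀ y ∂κ (t, x)) +
      ∫ s in (0 : ℝ)..t, Real.exp (-L * s) * ∫ y, g (u (t - s) y) ∂κ (s, x) := by
    conv_lhs => rw [← hfix]
    simp only [duhamel, max_eq_left ht]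
  have hsplit : ∀ s, ∫ y, (g (u (t - s) y) - L * u (t - s) y) ∂κ (s, x) =
      (∫ y, g (u (t - s) y) ∂κ (s, x)) - L * ∫ y, u (t - s) y ∂κ (s, x) := fun s => by
    rw [integral_sub (integrable_of_mem_Icc (hgs _) fun _ => hg _)
      ((integrable_of_mem_Icc (hus _) fun _ => hu' _ _).const_mul L), integral_const_mul]
  have key := fun (s : ℝ) (hs : s ∈ Icc 0 t) =>
    integral_fixed_point hgm hg hsemi hu₀ hu₀' hu hfix hs x
  have hih := intervalIntegrable_of_mem_Icc hm hh 0 t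
  have hiu := (intervalIntegrable_of_mem_Icc hmu hhu 0 t).const_mul L
  have hmass : ∫ s in (0 : ℝ)..t, L * ∫ y, u (t - s) y ∂κ (s, x) =
      (1 - Real.exp (-L * t)) * (∫ y, u₀ y ∂κ (t, x)) +
      ∫ q in (0 : ℝ)..t, (1 - Real.exp (-L * q)) * ∫ y, g (u (t - q) y) ∂κ (q, x) := by
    have hc : IntervalIntegrable
        (fun s => L * Real.exp (-L * (t - s)) * ∫ y, u₀ y ∂κ (t, x)) volume 0 t :=
      Continuous.intervalIntegrable (by fun_prop) _ _
    have heq : ∀ s ∈ uIcc 0 t, L * ∫ q in s..t,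
        Real.exp (-L * (q - s)) * ∫ y, g (u (t - q) y) ∂κ (q, x) =
        L * (∫ y, u (t - s) y ∂κ (s, x)) -
          L * Real.exp (-L * (t - s)) * ∫ y, u₀ y ∂κ (t, x) := by
      intro s hs
      rw [uIcc_of_le ht] at hs
      rw [key s hs]
      ring
    rw [← integral_integral_exp_mul hm hL hh ht, intervalIntegral.integral_congr heq,
      intervalIntegral.integral_sub hiu hc, intervalIntegral.integral_mul_const,
      intervalIntegral.integral_comp_sub_left (fun s => L * Real.exp (-L * s)) t,
      intervalIntegral_exp_neg_mul]
    simp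
  simp_rw [hsplit]
  rw [intervalIntegral.integral_sub hih hiu, hmass, hut]
  simp_rw [sub_mul, one_mul]
  rw [intervalIntegral.integral_sub hih (intervalIntegrable_exp_mul hm hh 0 t)]
  ring

end Picard

lemma exists_monotone_extension {f : ℝ → ℝ} (hf0 : 0 ≤ f 0) (hf1 : f 1 = 0) {L : NNReal}
    (hf : LipschitzOnWith L f (Icc 0 1)) :
    ∃ g : ℝ → ℝ, Continuous g ∧ (∀ r, g r ∈ Icc 0 (L : ℝ)) ∧ Monotone g ∧
      ∀ r ∈ Icc (0 : ℝ) 1, g r = f r + L * r := by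
  have hmono : MonotoneOn (fun r => f r + L * r) (Icc 0 1) := by
    intro a ha b hb hab
    have h := hf.dist_le_mul a ha b hb
    rw [Real.dist_eq, Real.dist_eq, abs_sub_comm a b, abs_of_nonneg (sub_nonneg.2 hab)] at h
    have := le_abs_self (f a - f b)
    simp only
    linarith
  have hcont : ContinuousOn (fun r => f r + L * r) (Icc 0 1) :=
    hf.continuousOn.add (by fun_prop)
  have h0 : (0 : ℝ) ∈ Icc (0 : ℝ) 1 := by simp
  have h1 : (1 : ℝ) ∈ Icc (0 : ℝ) 1 := by simp
  refine ⟨IccExtend zero_le_one ((Icc 0 1).domRestrict fun r => f r + L * r),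
    hcont.domRestrict.Icc_extend', fun r => ?_, ?_, fun r hr => ?_⟩
  · have hp := (projIcc (0 : ℝ) 1 zero_le_one r).2
    have ha := hmono h0 hp hp.1
    have hb := hmono hp h1 hp.2
    simp only [mul_zero, add_zero, mul_one, hf1, zero_add] at ha hb
    exact ⟨hf0.trans ha, hb⟩
  · exact Monotone.IccExtend _ fun a b hab => hmono a.2 b.2 hab
  · rw [IccExtend_of_mem _ _ hr, domRestrict_apply]

end MildSolution

/-- If `f(0) ≥ 0`, `f(1) = 0` and `f` is Lipschitz on `[0,1]`, then for
every measurable `u₀ : E → [0,1]` there is a mild solution `u` of `∂u/∂t = 𝓛u + f(u)`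
with initial condition `u₀` such that `u(t,x) ∈ [0,1]` for all `(t,x)`. -/
theorem exists_mild_solution_valued_in_unit_interval
    {E : Type*} [MeasurableSpace E] (P : ℝ → Kernel E E)
    [∀ t, IsMarkovKernel (P t)]
    (hP0 : P 0 = Kernel.id)
    (hPsemi : ∀ s ≥ (0:ℝ), ∀ t ≥ (0:ℝ), P (s + t) = (P s) ∘ₖ (P t))
    (hPmeas : ∀ g : E → ℝ, Measurable g → (∃ C, ∀ x, |g x| ≤ C) →
      Measurable (fun p : ℝ × E => ∫ y, g y ∂(P p.1 p.2)))
    (f : ℝ → ℝ) (hf0 : 0 ≤ f 0) (hf1 : f 1 = 0)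
    (hfLip : ∃ L : NNReal, LipschitzOnWith L f (Set.Icc 0 1))
    (u₀ : E → ℝ) (hu₀meas : Measurable u₀) (hu₀mem : ∀ x, u₀ x ∈ Set.Icc (0:ℝ) 1) :
    ∃ u : ℝ → E → ℝ, IsMildSolution P f u₀ u ∧
      ∀ t ≥ (0:ℝ), ∀ x, u t x ∈ Set.Icc (0:ℝ) 1 := by
  obtain ⟨L, hL⟩ := hfLip
  obtain ⟨g, hgc, hg, hmono, hgf⟩ := MildSolution.exists_monotone_extension hf0 hf1 hL
  let κ := MildSolution.jointKernel P hPmeas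
  have hsemi : ∀ s ≥ (0 : ℝ), ∀ r ≥ (0 : ℝ), ∀ φ : E → ℝ, Measurable φ →
      (∀ a b, (∀ y, φ y ∈ Set.Icc a b) → ∀ x,
        ∫ y, ∫ z, φ z ∂κ (r, y) ∂κ (s, x) = ∫ z, φ z ∂κ (s + r, x)) := by
    intro s hs r hr φ hφ a b hab x
    change ∫ y, ∫ z, φ z ∂P r y ∂P s x = ∫ z, φ z ∂P (s + r) x
    rw [add_comm s r, hPsemi r hr s hs,
      Kernel.integral_comp (MildSolution.integrable_of_mem_Icc hφ hab)]
  obtain ⟨u, hu, hu', hfix⟩ := MildSolution.exists_duhamel_eq (κ := κ) hgc hg hmono hu₀meas hu₀mem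
  have hsol : ∀ t ≥ (0:ℝ), ∀ x, u t x = (∫ y, u₀ y ∂(P t x)) +
      ∫ s in (0:ℝ)..t, ∫ y, f (u (t - s) y) ∂(P s x) := by
    intro t ht x
    have h := MildSolution.eq_of_duhamel_eq hgc.measurable hg hsemi hu₀meas hu₀mem hu hu' hfix ht x
    simp_rw [fun r y => hgf _ (hu' r y), add_sub_cancel_right] at h
    exact h
  refine ⟨u, ⟨hu, fun x => ?_, hsol⟩, fun t _ x => hu' t x⟩
  rw [hsol 0 le_rfl x, intervalIntegral.integral_same, add_zero, hP0, Kernel.id_apply,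
    integral_dirac' _ _ hu₀meas.stronglyMeasurable]
end

section
/- Suppose f : ℝ → ℝ is convex and differentiable on [0,1] and Lipschitz on [0,1], with f(0) ≥ 0, f(1) = 0, f'(1) = γ > 0, and let α ∈ [0,1) be the smaller root of f in [0,1]. Suppose ν_1 is not a Dirac mass. Let u be the [0,1]-valued mild solution of ∂u/∂t = 𝓛u + f(u) with Heaviside initial condition u_0(x) = 1_{x ≥ 0}, and set q := inf_{θ > 0} (Λ(θ) + γ)/θ (the infimum over θ > 0 at which Λ(θ) is finite). Then for every r ∈ ℝ: u(t, rt) → α as t → ∞ if r < q, and u(t, rt) → 1 as t → ∞ if r > q. -/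
open MeasureTheory Filter

/-- A mild solution of `∂u/∂t = 𝓛u + f(u)` on `ℝ`, where `𝓛` generates the Lévy
semigroup of kernels `(P_t φ)(x) = ∫ φ(x - y) dν_t(y)` associated with the convolution
semigroup `ν`. -/
def IsMildSolutionConv (ν : ℝ → Measure ℝ) (f : ℝ → ℝ) (u₀ : ℝ → ℝ)
    (u : ℝ → ℝ → ℝ) : Prop :=
  Measurable (Function.uncurry u) ∧ (∀ x, u 0 x = u₀ x) ∧
    ∀ t ≥ (0:ℝ), ∀ x, u t x = (∫ y, u₀ (x - y) ∂(ν t)) +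
      ∫ s in (0:ℝ)..t, ∫ y, f (u (t - s) (x - y)) ∂(ν s)

/-- Integrating factor identity for the primitive of an integrable function. -/
theorem exp_mul_sub_exp_mul_eq_integral {a b κ : ℝ} (hab : a ≤ b) {h D : ℝ → ℝ}
    (hh : IntervalIntegrable h volume a b)
    (hD : ∀ s ∈ Set.Icc a b, D s = D a + ∫ r in a..s, h r) :
    Real.exp (κ * b) * D b - Real.exp (κ * a) * D a =
      ∫ s in a..b, Real.exp (κ * s) * (h s + κ * D s) := by
  have hf : AbsolutelyContinuousOnInterval (fun s => Real.exp (κ * s)) a b :=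
    ContDiffOn.absolutelyContinuousOnInterval (by fun_prop)
  have hg0 := hh.absolutelyContinuousOnInterval_intervalIntegral (c := a) Set.left_mem_uIcc
  have hc : AbsolutelyContinuousOnInterval (fun _ : ℝ => D a) a b :=
    ContDiffOn.absolutelyContinuousOnInterval (by fun_prop)
  have hg : AbsolutelyContinuousOnInterval (fun s => D a + ∫ r in a..s, h r) a b := hc.add hg0
  have key := hf.integral_deriv_mul_eq_sub hg
  rw [hD b (Set.right_mem_Icc.2 hab)]
  simp only [intervalIntegral.integral_same, add_zero] at key
  rw [← key]
  apply intervalIntegral.integral_congr_ae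
  filter_upwards [hh.ae_hasDerivAt_integral] with x hx hxab
  have hxu : x ∈ Set.uIcc a b := Set.uIoc_subset_uIcc hxab
  have h1 : HasDerivAt (fun s => D a + ∫ r in a..s, h r) (h x) x :=
    (hx hxu a Set.left_mem_uIcc).const_add (D a)
  have h2 : HasDerivAt (fun s => Real.exp (κ * s)) (Real.exp (κ * x) * κ) x := by
    simpa using ((hasDerivAt_id x).const_mul κ).exp
  rw [h1.deriv, h2.deriv, hD x (by rwa [Set.uIcc_of_le hab] at hxu)]
  ring

theorem integrable_of_bounded {μ : Measure ℝ} [IsFiniteMeasure μ] {φ : ℝ → ℝ} {C : ℝ}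
    (hφ : Measurable φ) (hC : ∀ x, |φ x| ≤ C) : Integrable φ μ :=
  Integrable.of_bound hφ.aestronglyMeasurable C (ae_of_all _ hC)

/-- The semigroup property for the kernels of a convolution semigroup. -/
theorem integral_sub_add_eq {ν : ℝ → Measure ℝ} [∀ t, IsProbabilityMeasure (ν t)]
    (hνsemi : ∀ s ≥ (0:ℝ), ∀ t ≥ (0:ℝ), ν (s + t) = (ν s).conv (ν t))
    {φ : ℝ → ℝ} {C : ℝ} (hφ : Measurable φ) (hC : ∀ x, |φ x| ≤ C) {a b : ℝ} (ha : 0 ≤ a)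
    (hb : 0 ≤ b) (x : ℝ) :
    ∫ w, φ (x - w) ∂(ν (a + b)) = ∫ y, ∫ z, φ (x - y - z) ∂(ν b) ∂(ν a) := by
  rw [hνsemi a ha b hb, integral_conv]
  · simp only [sub_sub]
  · exact integrable_of_bounded (by fun_prop) (fun x => hC _)

theorem measurable_integral_semigroup {ν : ℝ → Measure ℝ} [∀ t, IsProbabilityMeasure (ν t)]
    (hνmeas : Measurable ν) {α : Type*} [MeasurableSpace α] {τ : α → ℝ} (hτ : Measurable τ)
    {G : α → ℝ → ℝ} (hG : Measurable (Function.uncurry G)) :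
    Measurable (fun p => ∫ z, G p z ∂(ν (τ p))) := by
  let k : ProbabilityTheory.Kernel α ℝ := ⟨fun p => ν (τ p), hνmeas.comp hτ⟩
  have : ProbabilityTheory.IsMarkovKernel k := ⟨fun p => by
    change IsProbabilityMeasure (ν (τ p)); infer_instance⟩
  exact (StronglyMeasurable.integral_kernel_prod_right (κ := k) hG.stronglyMeasurable).measurable

theorem abs_integral_le_of_bounded {μ : Measure ℝ} [IsProbabilityMeasure μ] {φ : ℝ → ℝ} {C : ℝ}
    (hC : ∀ x, |φ x| ≤ C) : |∫ y, φ y ∂μ| ≤ C := by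
  simpa using norm_integral_le_of_norm_le_const (μ := μ) (f := φ) (ae_of_all _ hC)

/-- Duhamel's formula, pushed forward by the semigroup from time `s` to time `t`. -/
theorem integral_duhamel {ν : ℝ → Measure ℝ} [∀ t, IsProbabilityMeasure (ν t)]
    (hνsemi : ∀ s ≥ (0:ℝ), ∀ t ≥ (0:ℝ), ν (s + t) = (ν s).conv (ν t))
    (hνmeas : Measurable ν) {u F : ℝ → ℝ → ℝ} {u₀ : ℝ → ℝ} {C : ℝ}
    (hF : Measurable (Function.uncurry F)) (hFC : ∀ t x, |F t x| ≤ C)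
    (hu₀ : Measurable u₀) (hu₀C : ∀ x, |u₀ x| ≤ C)
    (hu : ∀ t ≥ (0:ℝ), ∀ x, u t x = (∫ y, u₀ (x - y) ∂(ν t)) +
      ∫ s in (0:ℝ)..t, ∫ y, F (t - s) (x - y) ∂(ν s))
    {s t : ℝ} (hs : 0 ≤ s) (hst : s ≤ t) (x : ℝ) :
    ∫ y, u s (x - y) ∂(ν (t - s)) = (∫ y, u₀ (x - y) ∂(ν t)) +
      ∫ r in (0:ℝ)..s, ∫ y, F r (x - y) ∂(ν (t - r)) := by
  have hts : 0 ≤ t - s := by linarith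
  have hmeas : Measurable (fun p : ℝ × ℝ => ∫ z, F (s - p.1) (x - p.2 - z) ∂(ν p.1)) :=
    measurable_integral_semigroup hνmeas measurable_fst
      (G := fun p z => F (s - p.1) (x - p.2 - z))
      (hF.comp (by fun_prop : Measurable fun q : (ℝ × ℝ) × ℝ => (s - q.1.1, x - q.1.2 - q.2)))
  simp_rw [hu s hs]
  rw [integral_add]
  · congr 1
    · rw [← integral_sub_add_eq hνsemi hu₀ hu₀C hts hs, sub_add_cancel]
    · have hswap : ∫ y, (∫ r in (0:ℝ)..s, ∫ z, F (s - r) (x - y - z) ∂(ν r)) ∂(ν (t - s)) =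
          ∫ r in (0:ℝ)..s, ∫ y, ∫ z, F (s - r) (x - y - z) ∂(ν r) ∂(ν (t - s)) := by
        simp_rw [intervalIntegral.integral_of_le hs]
        rw [integral_integral_swap]
        refine Integrable.of_bound (C := C) ?_ (ae_of_all _ fun p => ?_)
        · exact (hmeas.comp measurable_swap).aestronglyMeasurable
        · exact abs_integral_le_of_bounded fun z => hFC _ _
      have hsub := intervalIntegral.integral_comp_sub_left (a := 0) (b := s)
        (fun r => ∫ y, F r (x - y) ∂(ν (t - r))) s
      simp only [sub_zero, sub_self] at hsub
      rw [hswap, ← hsub]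
      apply intervalIntegral.integral_congr
      intro r hr
      rw [Set.uIcc_of_le hs] at hr
      have h := integral_sub_add_eq hνsemi (φ := F (s - r)) (hF.comp measurable_prodMk_left)
        (hFC _) hts hr.1 x
      simp only
      rw [← h]
      congr 2
      ring
  · exact Integrable.of_bound (C := C)
      (measurable_integral_semigroup hνmeas (τ := fun _ => s) measurable_const
        (G := fun y z => u₀ (x - y - z)) (hu₀.comp (by fun_prop))).aestronglyMeasurable
      (ae_of_all _ fun y => abs_integral_le_of_bounded fun z => hu₀C _)
  · refine Integrable.of_bound (C := C * |s - 0|) ?_ (ae_of_all _ fun y => ?_)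
    · simp_rw [intervalIntegral.integral_of_le hs]
      exact ((hmeas.comp measurable_swap).stronglyMeasurable.integral_prod_right').aestronglyMeasurable
    · exact intervalIntegral.norm_integral_le_of_norm_le_const fun r _ =>
        abs_integral_le_of_bounded fun z => hFC _ _

/-- A `[0,1]`-valued mild solution, with Heaviside initial condition, of the equation driven by
a measurable convolution semigroup and a reaction term that is continuous on `[0,1]`. -/
structure IsUnitMildSolution (ν : ℝ → Measure ℝ) (f : ℝ → ℝ) (u : ℝ → ℝ → ℝ) : Prop where
  zero : ν 0 = Measure.dirac 0
  semi : ∀ s ≥ (0:ℝ), ∀ t ≥ (0:ℝ), ν (s + t) = (ν s).conv (ν t)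
  meas : Measurable ν
  cont : ContinuousOn f (Set.Icc 0 1)
  sol : IsMildSolutionConv ν f (fun x => if 0 ≤ x then (1:ℝ) else 0) u
  mem : ∀ t ≥ (0:ℝ), ∀ x, u t x ∈ Set.Icc (0:ℝ) 1

namespace IsUnitMildSolution

variable {ν : ℝ → Measure ℝ} {f : ℝ → ℝ} {u : ℝ → ℝ → ℝ}

theorem measurable_apply (hS : IsUnitMildSolution ν f u) (s : ℝ) : Measurable (u s) :=
  hS.sol.1.comp measurable_prodMk_left

theorem exists_extension (hS : IsUnitMildSolution ν f u) :
    ∃ (g : ℝ → ℝ) (C : ℝ), Continuous g ∧ 1 ≤ C ∧ (∀ v, |g v| ≤ C) ∧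
      ∀ v ∈ Set.Icc (0:ℝ) 1, g v = f v := by
  have hcont : Continuous (Set.IccExtend (zero_le_one' ℝ) ((Set.Icc (0:ℝ) 1).domRestrict f)) :=
    hS.cont.domRestrict.Icc_extend'
  obtain ⟨C, hC⟩ := isCompact_Icc.exists_bound_of_continuousOn hS.cont
  refine ⟨_, max C 1, hcont, le_max_right _ _, fun v => ?_, fun v hv => ?_⟩
  · exact (hC _ (Set.projIcc (0:ℝ) 1 zero_le_one v).2).trans (le_max_left _ _)
  · rw [Set.IccExtend_of_mem _ _ hv]; rfl

theorem integrable_apply (hS : IsUnitMildSolution ν f u) {μ : Measure ℝ} [IsFiniteMeasure μ]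
    {s : ℝ} (hs : 0 ≤ s) (x : ℝ) : Integrable (fun y => u s (x - y)) μ :=
  integrable_of_bounded (C := 1) ((hS.measurable_apply s).comp (by fun_prop)) fun y => by
    have := hS.mem s hs (x - y)
    exact abs_le.2 ⟨by linarith [this.1], this.2⟩

theorem integrable_reaction (hS : IsUnitMildSolution ν f u) {μ : Measure ℝ} [IsFiniteMeasure μ]
    {s : ℝ} (hs : 0 ≤ s) (x : ℝ) : Integrable (fun y => f (u s (x - y))) μ := by
  obtain ⟨g, C, hg, -, hgC, hgf⟩ := hS.exists_extension
  have : (fun y => f (u s (x - y))) = fun y => g (u s (x - y)) := by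
    ext y; rw [hgf _ (hS.mem s hs _)]
  rw [this]
  exact integrable_of_bounded (hg.measurable.comp ((hS.measurable_apply s).comp (by fun_prop)))
    fun y => hgC _

theorem integral_flow [∀ t, IsProbabilityMeasure (ν t)] (hS : IsUnitMildSolution ν f u)
    {t : ℝ} (x : ℝ) (ht : 0 ≤ t) :
    IntervalIntegrable (fun s => ∫ y, f (u s (x - y)) ∂(ν (t - s))) volume 0 t ∧
    ∀ s ∈ Set.Icc 0 t, ∫ y, u s (x - y) ∂(ν (t - s)) = (ν t).real (Set.Iic x) +
      ∫ r in (0:ℝ)..s, ∫ y, f (u r (x - y)) ∂(ν (t - r)) := by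
  obtain ⟨g, C, hg, hC1, hgC, hgf⟩ := hS.exists_extension
  have hgu : Measurable (Function.uncurry fun s x => g (u s x)) :=
    hg.measurable.comp hS.sol.1
  have hH : ∀ r, 0 ≤ r → ∀ y, g (u r (x - y)) = f (u r (x - y)) := fun r hr y =>
    hgf _ (hS.mem r hr _)
  constructor
  · have hm : Measurable (fun s => ∫ y, g (u s (x - y)) ∂(ν (t - s))) :=
      measurable_integral_semigroup hS.meas (τ := fun s => t - s) (by fun_prop)
        (G := fun s y => g (u s (x - y)))
        (hgu.comp (by fun_prop : Measurable fun q : ℝ × ℝ => (q.1, x - q.2)))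
    have hi : IntervalIntegrable (fun s => ∫ y, g (u s (x - y)) ∂(ν (t - s))) volume 0 t := by
      rw [intervalIntegrable_iff, Set.uIoc_of_le ht]
      exact Integrable.of_bound (C := C) hm.aestronglyMeasurable
        (ae_of_all _ fun s => abs_integral_le_of_bounded fun y => hgC _)
    refine hi.congr fun s hs => ?_
    rw [Set.uIoc_of_le ht] at hs
    simp only [hH s hs.1.le]
  · intro s hs
    have hmain := integral_duhamel hS.semi hS.meas (u := u) (F := fun s x => g (u s x))
      (u₀ := fun x => if 0 ≤ x then (1:ℝ) else 0) (C := C) hgu (fun t x => hgC _)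
      (Measurable.ite measurableSet_Ici measurable_const measurable_const)
      (fun x => by split_ifs <;> simp <;> linarith)
      (fun t ht x => by
        rw [hS.sol.2.2 t ht x]
        congr 1
        apply intervalIntegral.integral_congr
        intro r hr
        rw [Set.uIcc_of_le ht] at hr
        simp only [hgf _ (hS.mem (t - r) (by linarith [hr.2]) _)]) hs.1 hs.2 x
    rw [hmain]
    congr 1
    · have : (fun y => if 0 ≤ x - y then (1:ℝ) else 0) = (Set.Iic x).indicator 1 := by
        ext y; simp [Set.indicator_apply]
      rw [this, integral_indicator_one measurableSet_Iic]
    · apply intervalIntegral.integral_congr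
      intro r hr
      rw [Set.uIcc_of_le hs.1] at hr
      simp only [hH r hr.1]

theorem integral_flow_self (hS : IsUnitMildSolution ν f u) (t x : ℝ) :
    ∫ y, u t (x - y) ∂(ν (t - t)) = u t x := by
  rw [sub_self, hS.zero, integral_dirac, sub_zero]

/-- An affine lower bound on the reaction term integrates to an exponential bound. -/
theorem sub_le_of_affine_le [∀ t, IsProbabilityMeasure (ν t)] (hS : IsUnitMildSolution ν f u)
    {κ a : ℝ} (hf : ∀ v ∈ Set.Icc (0:ℝ) 1, κ * (a - v) ≤ f v) {t : ℝ} (ht : 0 ≤ t) (x : ℝ) :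
    a - u t x ≤ Real.exp (-(κ * t)) * (a - (ν t).real (Set.Iic x)) := by
  obtain ⟨hi, hU⟩ := hS.integral_flow x ht
  have h0 := hU 0 ⟨le_rfl, ht⟩
  rw [intervalIntegral.integral_same, add_zero] at h0
  have key := exp_mul_sub_exp_mul_eq_integral (κ := κ) ht hi
    (D := fun s => (∫ y, u s (x - y) ∂(ν (t - s))) - a) (fun s hs => by
      simp only [h0]; rw [hU s hs]; ring)
  rw [hS.integral_flow_self, h0] at key
  have hnn : 0 ≤ ∫ s in (0:ℝ)..t, Real.exp (κ * s) *
      ((∫ y, f (u s (x - y)) ∂(ν (t - s))) + κ * ((∫ y, u s (x - y) ∂(ν (t - s))) - a)) := by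
    refine intervalIntegral.integral_nonneg ht fun s hs => mul_nonneg (Real.exp_pos _).le ?_
    have h1 : ∫ y, κ * (a - u s (x - y)) ∂(ν (t - s)) ≤ ∫ y, f (u s (x - y)) ∂(ν (t - s)) :=
      integral_mono (((integrable_const a).sub (hS.integrable_apply hs.1 x)).const_mul κ)
        (hS.integrable_reaction hs.1 x) fun y => hf _ (hS.mem s hs.1 _)
    rw [integral_const_mul, integral_sub (integrable_const a) (hS.integrable_apply hs.1 x)] at h1
    simp only [integral_const, probReal_univ, one_smul] at h1
    linarith
  rw [← key] at hnn
  simp only [mul_zero, Real.exp_zero, one_mul] at hnn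
  have hexp : Real.exp (-(κ * t)) * Real.exp (κ * t) = 1 := by
    rw [← Real.exp_add]; simp
  have := mul_nonneg (Real.exp_pos (-(κ * t))).le hnn
  rw [mul_sub, ← mul_assoc, hexp] at this
  linarith

end IsUnitMildSolution

theorem exp_mul_sub_exp_mul_le_integral {a b κ : ℝ} (hab : a ≤ b) {h D m : ℝ → ℝ}
    (hh : IntervalIntegrable h volume a b)
    (hD : ∀ s ∈ Set.Icc a b, D s = D a + ∫ r in a..s, h r) (hm : Continuous m)
    (hle : ∀ s ∈ Set.Icc a b, h s + κ * D s ≤ m s) :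
    Real.exp (κ * b) * D b - Real.exp (κ * a) * D a ≤ ∫ s in a..b, Real.exp (κ * s) * m s := by
  rw [exp_mul_sub_exp_mul_eq_integral hab hh hD]
  have hDc : ContinuousOn D (Set.uIcc a b) := by
    have h1 : ContinuousOn (fun s => D a + ∫ r in a..s, h r) (Set.uIcc a b) :=
      continuousOn_const.add
        (hh.absolutelyContinuousOnInterval_intervalIntegral Set.left_mem_uIcc).continuousOn
    refine h1.congr fun s hs => ?_
    rw [Set.uIcc_of_le hab] at hs
    exact hD s hs
  refine intervalIntegral.integral_mono_on hab ?_
    (Continuous.intervalIntegrable (by fun_prop) _ _)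
    fun s hs => mul_le_mul_of_nonneg_left (hle s hs) (Real.exp_pos _).le
  exact (hh.add (hDc.intervalIntegrable.const_mul κ)).continuousOn_mul (by fun_prop)

/-- One-sided Lipschitz estimate comparing a reaction term that is convex with root `1` to its
chord. -/
theorem reaction_add_chord_le {f : ℝ → ℝ} (hconv : ConvexOn ℝ (Set.Icc 0 1) f) (hf1 : f 1 = 0)
    {L : ℝ} (hL : 0 < L)
    (hLip : ∀ v ∈ Set.Icc (0:ℝ) 1, ∀ w ∈ Set.Icc (0:ℝ) 1, |f v - f w| ≤ L * |v - w|)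
    {b κ : ℝ} (hb0 : 0 < b) (hb1 : b ≤ 1) (hfb : f (1 - b) ≤ -(κ * b)) {v w M : ℝ}
    (hv : v ∈ Set.Icc (0:ℝ) 1) (hw0 : 0 ≤ w) (hwb : w ≤ b) (hM : 0 ≤ M) (hvw : v - 1 + w ≤ M) :
    f v + κ * w + L * (v - 1 + w) ≤ 2 * L * M := by
  have hchord : f (1 - w) ≤ -(κ * w) := by
    have h := hconv.2 (show 1 - b ∈ Set.Icc (0:ℝ) 1 from ⟨by linarith, by linarith⟩)
      (show (1:ℝ) ∈ Set.Icc (0:ℝ) 1 from ⟨by norm_num, le_rfl⟩)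
      (show 0 ≤ w / b by positivity) (sub_nonneg.2 ((div_le_one hb0).2 hwb)) (by ring)
    simp only [smul_eq_mul, hf1, mul_zero, add_zero] at h
    have e : w / b * (1 - b) + (1 - w / b) * 1 = 1 - w := by field_simp; ring
    rw [e] at h
    refine h.trans ?_
    calc w / b * f (1 - b) ≤ w / b * -(κ * b) := mul_le_mul_of_nonneg_left hfb (by positivity)
      _ = -(κ * w) := by field_simp
  have h := (abs_le.1 (hLip v hv (1 - w) ⟨by linarith, by linarith⟩)).2
  rcases le_total 0 (v - (1 - w)) with h0 | h0
  · rw [abs_of_nonneg h0] at h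
    nlinarith
  · rw [abs_of_nonpos h0] at h
    nlinarith

namespace IsUnitMildSolution

variable {ν : ℝ → Measure ℝ} {f : ℝ → ℝ} {u : ℝ → ℝ → ℝ}

theorem measurable_real_Ioi (μ : Measure ℝ) [IsFiniteMeasure μ] (c : ℝ) :
    Measurable fun x => μ.real (Set.Ioi (x - c)) :=
  Antitone.measurable fun _ _ h => measureReal_mono (Set.Ioi_subset_Ioi (by linarith))

theorem integral_real_Ioi [∀ t, IsProbabilityMeasure (ν t)] (hS : IsUnitMildSolution ν f u)
    {a b : ℝ} (ha : 0 ≤ a) (hb : 0 ≤ b) (c x : ℝ) :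
    ∫ y, (ν b).real (Set.Ioi (x - y - c)) ∂(ν a) = (ν (a + b)).real (Set.Ioi (x - c)) := by
  have hind : ∀ (μ : Measure ℝ) (x : ℝ),
      ∫ w, (Set.Iio c).indicator (1 : ℝ → ℝ) (x - w) ∂μ = μ.real (Set.Ioi (x - c)) := by
    intro μ x
    rw [← integral_indicator_one measurableSet_Ioi]
    congr 1
    ext w
    simp only [Set.indicator_apply, Set.mem_Iio, Set.mem_Ioi, sub_lt_comm, Pi.one_apply]
  rw [← hind, integral_sub_add_eq hS.semi (C := 1)
    (measurable_one.indicator measurableSet_Iio) _ ha hb x]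
  · simp only [hind]
  · intro x
    by_cases hx : x ∈ Set.Iio c <;> simp [hx]

/-- The contraction step in the comparison of the solution with a moving-step subsolution. -/
theorem comparison_step [∀ t, IsProbabilityMeasure (ν t)] (hS : IsUnitMildSolution ν f u)
    (hconv : ConvexOn ℝ (Set.Icc 0 1) f) (hf1 : f 1 = 0) {L : ℝ} (hL : 0 < L)
    (hLip : ∀ v ∈ Set.Icc (0:ℝ) 1, ∀ w ∈ Set.Icc (0:ℝ) 1, |f v - f w| ≤ L * |v - w|)
    {b κ : ℝ} (hb0 : 0 < b) (hb1 : b ≤ 1) (hκ : 0 ≤ κ) (hfb : f (1 - b) ≤ -(κ * b))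
    {t₀ s c : ℝ} (ht₀ : 0 ≤ t₀)
    (hinit : ∀ x < c, u t₀ x ≤ 1 - b * Real.exp (-(κ * s))) {C : ℝ} (hC : 0 ≤ C)
    (hz : ∀ τ ∈ Set.Icc 0 s, ∀ x, u (t₀ + τ) x - 1 +
      b * Real.exp (-(κ * (s - τ))) * (ν τ).real (Set.Ioi (x - c)) ≤ C * Real.exp (4 * L * τ))
    {τ : ℝ} (hτ : τ ∈ Set.Icc 0 s) (x : ℝ) :
    u (t₀ + τ) x - 1 + b * Real.exp (-(κ * (s - τ))) * (ν τ).real (Set.Ioi (x - c)) ≤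
      C / 2 * Real.exp (4 * L * τ) := by
  set T := t₀ + τ with hT
  have hT0 : 0 ≤ T := by linarith [hτ.1]
  have ht₀T : t₀ ≤ T := by linarith [hτ.1]
  obtain ⟨hi, hU⟩ := hS.integral_flow x hT0
  set H : ℝ → ℝ := fun s => ∫ y, f (u s (x - y)) ∂(ν (T - s)) with hH
  set U : ℝ → ℝ := fun s => ∫ y, u s (x - y) ∂(ν (T - s)) with hUdef
  set p := (ν τ).real (Set.Ioi (x - c)) with hp
  set E : ℝ → ℝ := fun σ => b * Real.exp (-(κ * (s - (σ - t₀)))) with hE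
  have hEc : Continuous E := by fun_prop
  have hEderiv : ∀ σ, HasDerivAt (fun σ => E σ * p) (κ * E σ * p) σ := by
    intro σ
    have h1 : HasDerivAt (fun σ => -(κ * (s - (σ - t₀)))) κ σ := by
      have h0 := (((hasDerivAt_id σ).sub_const t₀).const_sub s).const_mul (-κ)
      simpa using h0
    have h2 := ((h1.exp.const_mul b).mul_const p)
    refine h2.congr_deriv ?_
    simp only [hE]; ring
  have hsub : Set.uIcc t₀ T ⊆ Set.uIcc 0 T := by
    rw [Set.uIcc_of_le ht₀T, Set.uIcc_of_le hT0]; exact Set.Icc_subset_Icc_left ht₀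
  have hi' : IntervalIntegrable H volume t₀ T := hi.mono_set hsub
  have hEi : ∀ a' b', IntervalIntegrable (fun σ => κ * E σ * p) volume a' b' := fun a' b' =>
    Continuous.intervalIntegrable (by fun_prop) _ _
  -- the two representations of the pushed-forward difference
  have hpw : ∀ σ ∈ Set.Icc t₀ T, Integrable
      (fun y => (ν (σ - t₀)).real (Set.Ioi (x - y - c))) (ν (T - σ)) := fun σ _ =>
    integrable_of_bounded (C := 1) ((measurable_real_Ioi _ c).comp (by fun_prop)) fun y => by
      rw [abs_of_nonneg measureReal_nonneg]; exact measureReal_le_one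
  have hpint : ∀ σ ∈ Set.Icc t₀ T,
      ∫ y, (ν (σ - t₀)).real (Set.Ioi (x - y - c)) ∂(ν (T - σ)) = p := by
    intro σ hσ
    rw [hS.integral_real_Ioi (by linarith [hσ.2]) (by linarith [hσ.1]), hp]
    congr 2
    rw [hT]; ring
  have hz' : ∀ σ ∈ Set.Icc t₀ T, ∀ y, u σ (x - y) - 1 +
      E σ * (ν (σ - t₀)).real (Set.Ioi (x - y - c)) ≤ C * Real.exp (4 * L * (σ - t₀)) := by
    intro σ hσ y
    have := hz (σ - t₀) ⟨by linarith [hσ.1], by linarith [hσ.2, hτ.2]⟩ (x - y)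
    rwa [add_sub_cancel] at this
  have hDint : ∀ σ ∈ Set.Icc t₀ T, U σ - 1 + E σ * p = ∫ y, (u σ (x - y) - 1 +
      E σ * (ν (σ - t₀)).real (Set.Ioi (x - y - c))) ∂(ν (T - σ)) := by
    intro σ hσ
    have hui := hS.integrable_apply (μ := ν (T - σ)) (ht₀.trans hσ.1) x
    have hu1 : Integrable (fun y => u σ (x - y) - 1) (ν (T - σ)) := hui.sub (integrable_const 1)
    rw [integral_add hu1 ((hpw σ hσ).const_mul _), integral_sub hui (integrable_const 1), integral_const_mul, hpint σ hσ]
    simp [hUdef]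
  have hD0 : U t₀ - 1 + E t₀ * p ≤ 0 := by
    rw [hDint t₀ ⟨le_rfl, ht₀T⟩]
    refine integral_nonpos fun y => ?_
    simp only [sub_self, hS.zero, hE, sub_zero, Pi.zero_apply]
    by_cases hy : x - y < c
    · have h1 : (Measure.dirac (0:ℝ)).real (Set.Ioi (x - y - c)) = 1 := by
        rw [measureReal_def, Measure.dirac_apply_of_mem (by simpa using hy)]; simp
      rw [h1]; linarith [hinit _ hy]
    · have h1 : (Measure.dirac (0:ℝ)).real (Set.Ioi (x - y - c)) = 0 := by
        rw [measureReal_def, Measure.dirac_apply' _ measurableSet_Ioi,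
          Set.indicator_of_notMem (by simpa using hy), ENNReal.toReal_zero]
      rw [h1]; linarith [(hS.mem t₀ ht₀ (x - y)).2]
  have hprim : ∀ σ ∈ Set.Icc t₀ T, U σ - 1 + E σ * p =
      (U t₀ - 1 + E t₀ * p) + ∫ r in t₀..σ, (H r + κ * E r * p) := by
    intro σ hσ
    have hi1 : IntervalIntegrable H volume 0 t₀ := hi.mono_set (by
      rw [Set.uIcc_of_le ht₀, Set.uIcc_of_le hT0]; exact Set.Icc_subset_Icc_right ht₀T)
    have hi2 : IntervalIntegrable H volume t₀ σ := hi'.mono_set (by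
      rw [Set.uIcc_of_le hσ.1, Set.uIcc_of_le ht₀T]; exact Set.Icc_subset_Icc_right hσ.2)
    rw [intervalIntegral.integral_add hi2 (hEi _ _),
      intervalIntegral.integral_eq_sub_of_hasDerivAt (fun σ _ => hEderiv σ) (hEi _ _)]
    have e1 : U σ = _ := hU σ ⟨ht₀.trans hσ.1, hσ.2⟩
    have e2 : U t₀ = _ := hU t₀ ⟨ht₀, ht₀T⟩
    have e3 := intervalIntegral.integral_add_adjacent_intervals hi1 hi2
    rw [e1, e2, ← e3]
    ring
  have key := exp_mul_sub_exp_mul_le_integral (κ := L) ht₀T (hi'.add (hEi _ _))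
    (D := fun σ => U σ - 1 + E σ * p)
    (m := fun σ => 2 * L * (C * Real.exp (4 * L * (σ - t₀)))) hprim (by fun_prop) (by
      intro σ hσ
      have hσ0 := ht₀.trans hσ.1
      have hui := hS.integrable_apply (μ := ν (T - σ)) hσ0 x
      have hfi := hS.integrable_reaction (μ := ν (T - σ)) hσ0 x
      have hEp := (hpw σ hσ).const_mul (E σ)
      have hzi : Integrable (fun y => u σ (x - y) - 1 +
          E σ * (ν (σ - t₀)).real (Set.Ioi (x - y - c))) (ν (T - σ)) :=
        (hui.sub (integrable_const 1)).add hEp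
      have hfE : Integrable (fun y => f (u σ (x - y)) +
          κ * (E σ * (ν (σ - t₀)).real (Set.Ioi (x - y - c)))) (ν (T - σ)) :=
        hfi.add (hEp.const_mul κ)
      have hle : ∫ y, (f (u σ (x - y)) + κ * (E σ * (ν (σ - t₀)).real (Set.Ioi (x - y - c))) +
          L * (u σ (x - y) - 1 + E σ * (ν (σ - t₀)).real (Set.Ioi (x - y - c)))) ∂(ν (T - σ)) ≤
          ∫ y, 2 * L * (C * Real.exp (4 * L * (σ - t₀))) ∂(ν (T - σ)) := by
        refine integral_mono (hfE.add (hzi.const_mul L))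
          (integrable_const _) fun y => ?_
        have hEle : E σ ≤ b := by
          have : Real.exp (-(κ * (s - (σ - t₀)))) ≤ 1 := by
            rw [Real.exp_le_one_iff]
            have : 0 ≤ κ * (s - (σ - t₀)) := mul_nonneg hκ (by linarith [hσ.2, hτ.2])
            linarith
          simp only [hE]; nlinarith
        have hE0 : 0 ≤ E σ := by simp only [hE]; positivity
        have hp0 : 0 ≤ (ν (σ - t₀)).real (Set.Ioi (x - y - c)) := measureReal_nonneg
        have hp1 : (ν (σ - t₀)).real (Set.Ioi (x - y - c)) ≤ 1 := measureReal_le_one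
        exact reaction_add_chord_le hconv hf1 hL hLip hb0 hb1 hfb (hS.mem σ hσ0 _)
          (mul_nonneg hE0 hp0) ((mul_le_of_le_one_right hE0 hp1).trans hEle)
          (by positivity) (hz' σ hσ y)
      rw [integral_add hfE (hzi.const_mul L),
        integral_add hfi (hEp.const_mul κ), integral_const_mul, integral_const_mul,
        integral_const_mul, hpint σ hσ, ← hDint σ hσ] at hle
      simp only [integral_const, probReal_univ, one_smul] at hle
      linarith [hle])
  have hUT : U T = u T x := hS.integral_flow_self T x
  have hET : E T = b * Real.exp (-(κ * (s - τ))) := by simp only [hE, hT, add_sub_cancel_left]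
  simp only [hUT, hET] at key
  have hintg : ∫ σ in t₀..T, Real.exp (L * σ) * (2 * L * (C * Real.exp (4 * L * (σ - t₀)))) ≤
      Real.exp (L * T) * (C / 2 * Real.exp (4 * L * τ)) := by
    have hd : ∀ σ, HasDerivAt (fun σ => Real.exp (L * T) * (C / 2 * Real.exp (4 * L * (σ - t₀))))
        (Real.exp (L * T) * (2 * L * (C * Real.exp (4 * L * (σ - t₀))))) σ := by
      intro σ
      have h1 : HasDerivAt (fun σ => 4 * L * (σ - t₀)) (4 * L) σ := by
        simpa using ((hasDerivAt_id σ).sub_const t₀).const_mul (4 * L)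
      refine ((h1.exp.const_mul (C / 2)).const_mul (Real.exp (L * T))).congr_deriv ?_
      ring
    calc _ ≤ ∫ σ in t₀..T, Real.exp (L * T) * (2 * L * (C * Real.exp (4 * L * (σ - t₀)))) := by
          refine intervalIntegral.integral_mono_on ht₀T
            (Continuous.intervalIntegrable (by fun_prop) _ _)
            (Continuous.intervalIntegrable (by fun_prop) _ _) fun σ hσ => ?_
          refine mul_le_mul_of_nonneg_right (Real.exp_le_exp.2 ?_) (by positivity)
          nlinarith [hσ.2]
      _ = _ := intervalIntegral.integral_eq_sub_of_hasDerivAt (fun σ _ => hd σ)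
            (Continuous.intervalIntegrable (by fun_prop) _ _)
      _ ≤ _ := by
          have e : T - t₀ = τ := by rw [hT]; ring
          rw [e]
          have : 0 ≤ Real.exp (L * T) * (C / 2 * Real.exp (4 * L * (t₀ - t₀))) := by positivity
          linarith
  have h3 : Real.exp (L * t₀) * (U t₀ - 1 + E t₀ * p) ≤ 0 :=
    mul_nonpos_of_nonneg_of_nonpos (Real.exp_pos _).le hD0
  exact le_of_mul_le_mul_left (by linarith) (Real.exp_pos (L * T))

/-- Comparison with a subsolution that is a growing step function smoothed by the semigroup. -/
theorem le_one_sub_of_initial_le [∀ t, IsProbabilityMeasure (ν t)]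
    (hS : IsUnitMildSolution ν f u)
    (hconv : ConvexOn ℝ (Set.Icc 0 1) f) (hf1 : f 1 = 0) {L : ℝ} (hL : 0 < L)
    (hLip : ∀ v ∈ Set.Icc (0:ℝ) 1, ∀ w ∈ Set.Icc (0:ℝ) 1, |f v - f w| ≤ L * |v - w|)
    {b κ : ℝ} (hb0 : 0 < b) (hb1 : b ≤ 1) (hκ : 0 ≤ κ) (hfb : f (1 - b) ≤ -(κ * b))
    {t₀ s c : ℝ} (ht₀ : 0 ≤ t₀) (hs : 0 ≤ s)
    (hinit : ∀ x < c, u t₀ x ≤ 1 - b * Real.exp (-(κ * s))) (x : ℝ) :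
    u (t₀ + s) x ≤ 1 - b * (ν s).real (Set.Ioi (x - c)) := by
  have hn : ∀ n : ℕ, ∀ τ ∈ Set.Icc 0 s, ∀ x, u (t₀ + τ) x - 1 +
      b * Real.exp (-(κ * (s - τ))) * (ν τ).real (Set.Ioi (x - c)) ≤
      (1 / 2) ^ n * Real.exp (4 * L * τ) := by
    intro n
    induction n with
    | zero =>
      intro τ hτ x
      have h1 : 1 ≤ Real.exp (4 * L * τ) := Real.one_le_exp (mul_nonneg (by linarith) hτ.1)
      have h2 : Real.exp (-(κ * (s - τ))) ≤ 1 := by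
        rw [Real.exp_le_one_iff]
        have : 0 ≤ κ * (s - τ) := mul_nonneg hκ (by linarith [hτ.2])
        linarith
      have h3 : b * Real.exp (-(κ * (s - τ))) ≤ 1 := mul_le_one₀ hb1 (Real.exp_pos _).le h2
      have h4 : b * Real.exp (-(κ * (s - τ))) * (ν τ).real (Set.Ioi (x - c)) ≤ 1 :=
        mul_le_one₀ h3 measureReal_nonneg measureReal_le_one
      have := (hS.mem (t₀ + τ) (by linarith [hτ.1]) x).2
      simp only [pow_zero, one_mul]
      linarith
    | succ n ih =>
      intro τ hτ x
      have := hS.comparison_step hconv hf1 hL hLip hb0 hb1 hκ hfb ht₀ hinit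
        (by positivity) ih hτ x
      rwa [pow_succ, mul_one_div]
  have hlim : Tendsto (fun n : ℕ => (1 / 2 : ℝ) ^ n * Real.exp (4 * L * s)) atTop (nhds 0) := by
    simpa using (tendsto_pow_atTop_nhds_zero_of_lt_one (r := (1 / 2 : ℝ)) (by norm_num)
      (by norm_num)).mul_const (Real.exp (4 * L * s))
  have := ge_of_tendsto' hlim fun n => hn n s ⟨hs, le_rfl⟩ x
  simp only [sub_self, mul_zero, neg_zero, Real.exp_zero, mul_one] at this
  linarith

end IsUnitMildSolution

/-- A measurable additive function on the half-line is linear. -/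
theorem eq_mul_of_measurable_of_add {m : ℝ → ℝ} (hm : Measurable m)
    (hadd : ∀ s ≥ (0:ℝ), ∀ t ≥ (0:ℝ), m (s + t) = m s + m t) {t : ℝ} (ht : 0 ≤ t) :
    m t = t * m 1 := by
  have h0 : m 0 = 0 := by have := hadd 0 le_rfl 0 le_rfl; rw [add_zero] at this; linarith
  let φ : ℝ →+ ℝ := AddMonoidHom.mk' (fun t => m (max t 0) - m (max (-t) 0)) fun a b => by
    have ha : 0 ≤ max a 0 := le_max_right _ _
    have hb : 0 ≤ max b 0 := le_max_right _ _
    have hc : 0 ≤ max (a + b) 0 := le_max_right _ _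
    have ha' : 0 ≤ max (-a) 0 := le_max_right _ _
    have hb' : 0 ≤ max (-b) 0 := le_max_right _ _
    have hc' : 0 ≤ max (-(a + b)) 0 := le_max_right _ _
    have ea : max a 0 - max (-a) 0 = a := by grind
    have eb : max b 0 - max (-b) 0 = b := by grind
    have ec : max (a + b) 0 - max (-(a + b)) 0 = a + b := by grind
    have e : max (a + b) 0 + max (-a) 0 + max (-b) 0 =
        max (-(a + b)) 0 + max a 0 + max b 0 := by linarith
    have := congrArg m e
    rw [hadd _ (by positivity) _ hb', hadd _ hc _ ha', hadd _ (by positivity) _ hb,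
      hadd _ hc' _ ha] at this
    linarith
  have hφ : Continuous φ := MeasureTheory.Measure.AddMonoidHom.continuous_of_measurable φ (by
    change Measurable fun t => m (max t 0) - m (max (-t) 0)
    exact (hm.comp (by fun_prop)).sub (hm.comp (by fun_prop)))
  have h := (φ.toRealLinearMap hφ).map_smul t 1
  have h1 : ∀ x ≥ (0:ℝ), φ x = m x := fun x hx => by
    change m (max x 0) - m (max (-x) 0) = m x
    rw [max_eq_left hx, max_eq_right (by linarith), h0, sub_zero]
  simpa [h1 t ht, h1 1 zero_le_one] using h

/-- Exponential moments along a measurable convolution semigroup. -/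
theorem integral_exp_semigroup {ν : ℝ → Measure ℝ} [∀ t, IsProbabilityMeasure (ν t)]
    (hνsemi : ∀ s ≥ (0:ℝ), ∀ t ≥ (0:ℝ), ν (s + t) = (ν s).conv (ν t))
    (hνmeas : Measurable ν) {θ : ℝ} (hθ : Integrable (fun y => Real.exp (θ * y)) (ν 1))
    {t : ℝ} (ht : 0 ≤ t) :
    Integrable (fun y => Real.exp (θ * y)) (ν t) ∧
      ∫ y, Real.exp (θ * y) ∂(ν t) =
        Real.exp (t * Real.log (∫ y, Real.exp (θ * y) ∂(ν 1))) := by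
  set M : ℝ → ENNReal := fun t => ∫⁻ y, ENNReal.ofReal (Real.exp (θ * y)) ∂(ν t) with hM
  have hMm : Measurable M := (Measure.measurable_lintegral (by fun_prop)).comp hνmeas
  have hMadd : ∀ s ≥ (0:ℝ), ∀ t ≥ (0:ℝ), M (s + t) = M s * M t := by
    intro s hs t ht
    simp only [hM]
    rw [hνsemi s hs t ht, Measure.lintegral_conv (by fun_prop)]
    simp_rw [mul_add, Real.exp_add, ENNReal.ofReal_mul (Real.exp_pos _).le]
    rw [← lintegral_mul_const _ (by fun_prop)]
    congr 1
    ext x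
    rw [lintegral_const_mul _ (by fun_prop)]
  have hMpos : ∀ t, M t ≠ 0 := by
    intro t h
    rw [hM, lintegral_eq_zero_iff (by fun_prop)] at h
    have : ∀ᵐ y ∂(ν t), False := by
      filter_upwards [h] with y hy
      simp only [Pi.zero_apply, ENNReal.ofReal_eq_zero] at hy
      exact absurd hy (not_le.2 (Real.exp_pos _))
    simp at this
    exact IsProbabilityMeasure.ne_zero (ν t) this
  have hM1 : M 1 ≠ ⊤ := (lintegral_ofReal_ne_top_iff_integrable (by fun_prop)
    (ae_of_all _ fun y => (Real.exp_pos _).le)).2 hθ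
  have hMn : ∀ n : ℕ, M (n + 1) ≠ ⊤ := by
    intro n
    induction n with
    | zero => simpa using hM1
    | succ n ih =>
      rw [hMadd _ (by positivity) _ zero_le_one]
      push_cast
      exact ENNReal.mul_ne_top ih hM1
  have hMfin : ∀ t ≥ (0:ℝ), M t ≠ ⊤ := by
    intro t ht htop
    obtain ⟨n, hn⟩ := exists_nat_ge t
    have h := hMadd t ht (n + 1 - t) (by linarith)
    rw [add_sub_cancel, htop, ENNReal.top_mul (hMpos _)] at h
    exact hMn n h
  have hInt : ∀ t ≥ (0:ℝ), Integrable (fun y => Real.exp (θ * y)) (ν t) := fun t ht =>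
    (lintegral_ofReal_ne_top_iff_integrable (by fun_prop)
      (ae_of_all _ fun y => (Real.exp_pos _).le)).1 (hMfin t ht)
  have hval : ∀ t ≥ (0:ℝ), ∫ y, Real.exp (θ * y) ∂(ν t) = (M t).toReal := fun t ht =>
    integral_eq_lintegral_of_nonneg_ae (ae_of_all _ fun y => (Real.exp_pos _).le)
      (hInt t ht).aestronglyMeasurable
  have hlin := eq_mul_of_measurable_of_add (m := fun t => Real.log (M t).toReal)
    (Real.measurable_log.comp hMm.ennreal_toReal) (fun s hs t ht => by
      rw [hMadd s hs t ht, ENNReal.toReal_mul, Real.log_mul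
        (ENNReal.toReal_ne_zero.2 ⟨hMpos s, hMfin s hs⟩)
        (ENNReal.toReal_ne_zero.2 ⟨hMpos t, hMfin t ht⟩)]) ht
  refine ⟨hInt t ht, ?_⟩
  rw [hval t ht, hval 1 zero_le_one, ← hlin, Real.exp_log]
  exact ENNReal.toReal_pos (hMpos t) (hMfin t ht)

theorem integrable_exp_restrict_Iic {μ : Measure ℝ} [IsFiniteMeasure μ] {ε : ℝ}
    (hε : ∀ θ : ℝ, |θ| < ε → Integrable (fun y => Real.exp (θ * y)) μ) (K ρ : ℝ) {θ : ℝ}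
    (hθ : -ε < θ) : Integrable (fun y => Real.exp (θ * (y - ρ))) (μ.restrict (Set.Iic K)) := by
  rcases le_or_gt 0 θ with h | h
  · refine Integrable.of_bound (C := Real.exp (θ * (K - ρ))) (by fun_prop) ?_
    filter_upwards [ae_restrict_mem measurableSet_Iic] with y hy
    rw [Real.norm_eq_abs, Real.abs_exp]
    exact Real.exp_le_exp.2 (mul_le_mul_of_nonneg_left (sub_le_sub_right hy _) h)
  · have := ((hε θ (by rw [abs_of_neg h]; linarith)).restrict (s := Set.Iic K)).const_mul
      (Real.exp (-(θ * ρ)))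
    refine this.congr (ae_of_all _ fun y => ?_)
    simp only [← Real.exp_add]
    ring_nf

theorem differentiableAt_mgf_restrict_Iic {μ : Measure ℝ} [IsFiniteMeasure μ] {ε : ℝ}
    (hε : ∀ θ : ℝ, |θ| < ε → Integrable (fun y => Real.exp (θ * y)) μ) (K ρ : ℝ) {θ : ℝ}
    (hθ : -ε < θ) :
    DifferentiableAt ℝ (ProbabilityTheory.mgf (fun y => y - ρ) (μ.restrict (Set.Iic K))) θ := by
  refine ProbabilityTheory.differentiableAt_mgf ?_
  rw [mem_interior]
  exact ⟨Set.Ioi (-ε), fun t ht => integrable_exp_restrict_Iic hε K ρ ht, isOpen_Ioi, hθ⟩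

theorem le_mgf_restrict_Iic {μ : Measure ℝ} [IsFiniteMeasure μ] {ε : ℝ} (hε0 : 0 < ε)
    (hε : ∀ θ : ℝ, |θ| < ε → Integrable (fun y => Real.exp (θ * y)) μ) {K ρ η θ : ℝ}
    (hθ : 0 ≤ θ) :
    μ.real (Set.Ioc (ρ + η) K) * Real.exp (θ * η) ≤
      ProbabilityTheory.mgf (fun y => y - ρ) (μ.restrict (Set.Iic K)) θ := by
  have hi := integrable_exp_restrict_Iic hε K ρ (by linarith : -ε < θ)
  have h1 : ∫ y in Set.Ioc (ρ + η) K, Real.exp (θ * (y - ρ)) ∂μ ≤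
      ∫ y in Set.Iic K, Real.exp (θ * (y - ρ)) ∂μ :=
    setIntegral_mono_set hi (ae_of_all _ fun y => (Real.exp_pos _).le)
      (LE.le.eventuallyLE Set.Ioc_subset_Iic_self)
  refine le_trans ?_ h1
  have h2 := setIntegral_mono_on (μ := μ) (s := Set.Ioc (ρ + η) K)
    (f := fun _ => Real.exp (θ * η)) (integrable_const _).integrableOn
    (IntegrableOn.mono_set hi Set.Ioc_subset_Iic_self) measurableSet_Ioc
    fun y hy => Real.exp_le_exp.2 (mul_le_mul_of_nonneg_left (by linarith [hy.1]) hθ)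
  simpa using h2

/-- Some bounded window strictly above `ρ` is charged as soon as `(ρ, ∞)` is. -/
theorem exists_Ioc_pos {μ : Measure ℝ} [IsFiniteMeasure μ] {ρ : ℝ} (h : μ (Set.Ioi ρ) ≠ 0) :
    ∃ η > (0:ℝ), ∃ K₀ : ℕ, ∀ K : ℝ, K₀ ≤ K → 0 < μ.real (Set.Ioc (ρ + η) K) := by
  by_contra! hcon
  apply h
  have hsub : Set.Ioi ρ ⊆ ⋃ n : ℕ, Set.Ioc (ρ + 1 / (n + 1 : ℝ)) n := by
    intro y hy
    obtain ⟨n, hn⟩ := exists_nat_one_div_lt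
      (sub_pos.2 (Set.mem_Ioi.1 hy) : 0 < y - ρ)
    obtain ⟨m, hm⟩ := exists_nat_ge y
    refine Set.mem_iUnion.2 ⟨max n m, ?_, hm.trans (by simp)⟩
    have : 1 / ((max n m : ℕ) + 1 : ℝ) ≤ 1 / (n + 1 : ℝ) := by
      apply one_div_le_one_div_of_le (by positivity)
      simp
    linarith
  refine measure_mono_null hsub (measure_iUnion_null fun n => ?_)
  obtain ⟨K, hK, hK0⟩ := hcon (1 / (n + 1 : ℝ)) (by positivity) n
  have h0 : μ.real (Set.Ioc (ρ + 1 / (n + 1 : ℝ)) n) = 0 :=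
    le_antisymm ((measureReal_mono (Set.Ioc_subset_Ioc_right hK)).trans hK0) measureReal_nonneg
  exact (measureReal_eq_zero_iff (by finiteness)).1 h0

/-- A strict lower bound on a moment generating function on the half-line already holds for a
truncation of the measure. -/
theorem exists_truncation_lt_mgf {μ : Measure ℝ} [IsFiniteMeasure μ] {ε : ℝ} (hε0 : 0 < ε)
    (hε : ∀ θ : ℝ, |θ| < ε → Integrable (fun y => Real.exp (θ * y)) μ) {ρ η g : ℝ} (hg : 0 < g)
    (hη : 0 < η) {K₀ : ℕ} (hK₀ : ∀ K : ℝ, K₀ ≤ K → 0 < μ.real (Set.Ioc (ρ + η) K))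
    (hlt : ∀ θ ≥ (0:ℝ), Integrable (fun y => Real.exp (θ * (y - ρ))) μ →
      g < ∫ y, Real.exp (θ * (y - ρ)) ∂μ) :
    ∃ K : ℝ, K₀ ≤ K ∧ ∀ θ ≥ (0:ℝ),
      g < ProbabilityTheory.mgf (fun y => y - ρ) (μ.restrict (Set.Iic K)) θ := by
  by_contra! hcon
  set h : ℕ → ℝ → ℝ := fun n =>
    ProbabilityTheory.mgf (fun y => y - ρ) (μ.restrict (Set.Iic ((K₀ + n : ℕ) : ℝ))) with hh
  set S : ℕ → Set ℝ := fun n => Set.Ici 0 ∩ {θ | h n θ ≤ g} with hS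
  have hanti : ∀ n, S (n + 1) ⊆ S n := by
    rintro n θ ⟨hθ, hle⟩
    refine ⟨hθ, ?_⟩
    change h (n + 1) θ ≤ g at hle
    change h n θ ≤ g
    refine le_trans ?_ hle
    refine setIntegral_mono_set (integrable_exp_restrict_Iic hε _ ρ
      (by linarith [Set.mem_Ici.1 hθ] : -ε < θ)) (ae_of_all _ fun y => (Real.exp_pos _).le)
      (LE.le.eventuallyLE (Set.Iic_subset_Iic.2 ?_))
    push_cast; linarith
  have hne : ∀ n, (S n).Nonempty := by
    intro n
    obtain ⟨θ, hθ, hle⟩ := hcon ((K₀ + n : ℕ) : ℝ) (by simp)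
    exact ⟨θ, hθ, hle⟩
  have hcl : ∀ n, IsClosed (S n) := by
    intro n
    have hc : ContinuousOn (h n) (Set.Ici 0) := fun θ hθ =>
      (differentiableAt_mgf_restrict_Iic hε _ ρ
        (by linarith [Set.mem_Ici.1 hθ] : -ε < θ)).continuousAt.continuousWithinAt
    exact hc.preimage_isClosed_of_isClosed isClosed_Ici isClosed_Iic
  have hcpt : IsCompact (S 0) := by
    set p := μ.real (Set.Ioc (ρ + η) K₀) with hp
    have hp0 : 0 < p := hK₀ K₀ le_rfl
    refine (isCompact_Icc (a := (0:ℝ)) (b := g / p / η)).of_isClosed_subset (hcl 0) ?_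
    rintro θ ⟨hθ, hle⟩
    refine ⟨hθ, ?_⟩
    have h1 := le_mgf_restrict_Iic hε0 hε (K := K₀) (ρ := ρ) (η := η) (Set.mem_Ici.1 hθ)
    have h2 : p * Real.exp (θ * η) ≤ g := h1.trans (by simpa [hh] using hle)
    have h3 := Real.add_one_le_exp (θ * η)
    rw [le_div_iff₀ hη, le_div_iff₀ hp0]
    nlinarith
  obtain ⟨θ, hθ⟩ := IsCompact.nonempty_iInter_of_sequence_nonempty_isCompact_isClosed S hanti hne
    hcpt hcl
  rw [Set.mem_iInter] at hθ
  have hθ0 : 0 ≤ θ := (hθ 0).1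
  have hlint : ∫⁻ y, ENNReal.ofReal (Real.exp (θ * (y - ρ))) ∂μ ≤ ENNReal.ofReal g := by
    have hU : (⋃ n : ℕ, Set.Iic ((K₀ + n : ℕ) : ℝ)) = Set.univ := by
      refine Set.eq_univ_of_forall fun y => ?_
      obtain ⟨n, hn⟩ := exists_nat_ge y
      refine Set.mem_iUnion.2 ⟨n, hn.trans ?_⟩
      push_cast; linarith [(Nat.cast_nonneg K₀ : (0:ℝ) ≤ K₀)]
    rw [← setLIntegral_univ, ← hU, setLIntegral_iUnion_of_directed]
    · refine iSup_le fun n => ?_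
      rw [← ofReal_integral_eq_lintegral_ofReal
        (integrable_exp_restrict_Iic hε _ ρ (by linarith : -ε < θ))
        (ae_of_all _ fun y => (Real.exp_pos _).le)]
      exact ENNReal.ofReal_le_ofReal (hθ n).2
    · refine directed_of_isDirected_le fun a b hab => Set.Iic_subset_Iic.2 ?_
      exact_mod_cast Nat.add_le_add_left hab K₀
  have hintg : Integrable (fun y => Real.exp (θ * (y - ρ))) μ :=
    (lintegral_ofReal_ne_top_iff_integrable (by fun_prop)
      (ae_of_all _ fun y => (Real.exp_pos _).le)).1 (ne_top_of_le_ne_top (by finiteness) hlint)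
  rw [← ofReal_integral_eq_lintegral_ofReal hintg (ae_of_all _ fun y => (Real.exp_pos _).le),
    ENNReal.ofReal_le_ofReal_iff hg.le] at hlint
  exact absurd (hlt θ hθ0 hintg) (not_lt.2 hlint)

theorem exists_lt_of_hasDerivAt_neg {g : ℝ → ℝ} {d : ℝ} (hg : HasDerivAt g d 0) (hd : d < 0)
    {δ₀ : ℝ} (hδ₀ : 0 < δ₀) : ∃ δ ∈ Set.Ioo 0 δ₀, g δ < g 0 := by
  have h := (hasDerivAt_iff_tendsto_slope_zero.1 hg).mono_left
    (nhdsWithin_mono 0 (fun x (hx : x ∈ Set.Ioi (0:ℝ)) => ne_of_gt hx))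
  have hev := (h.eventually (gt_mem_nhds hd)).and (Ioo_mem_nhdsGT hδ₀)
  obtain ⟨δ, h1, h2⟩ := hev.exists
  refine ⟨δ, h2, ?_⟩
  rw [zero_add, smul_eq_mul] at h1
  have : 0 < δ⁻¹ := inv_pos.2 h2.1
  nlinarith

theorem conv_mono {μ μ' κ κ' : Measure ℝ} [SFinite κ] [SFinite κ'] (h : μ ≤ μ') (h' : κ ≤ κ') :
    μ.conv κ ≤ μ'.conv κ' := by
  refine Measure.le_iff.2 fun s hs => ?_
  have hm : Measurable (s.indicator (1 : ℝ → ENNReal)) := measurable_one.indicator hs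
  rw [← lintegral_indicator_one hs, ← lintegral_indicator_one hs, Measure.lintegral_conv hm,
    Measure.lintegral_conv hm]
  exact lintegral_mono' h fun x => lintegral_mono' h' le_rfl

theorem exists_convolution_powers {ν : ℝ → Measure ℝ} [∀ t, IsProbabilityMeasure (ν t)]
    (hν0 : ν 0 = Measure.dirac 0)
    (hνsemi : ∀ s ≥ (0:ℝ), ∀ t ≥ (0:ℝ), ν (s + t) = (ν s).conv (ν t))
    {μ : Measure ℝ} [IsFiniteMeasure μ] (hμ : μ ≤ ν 1) (ρ : ℝ) (k : ℕ) :
    ∃ m : Measure ℝ, m ≤ ν k ∧ ∀ θ : ℝ,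
      ∫⁻ y, ENNReal.ofReal (Real.exp (θ * (y - k * ρ))) ∂m =
        (∫⁻ y, ENNReal.ofReal (Real.exp (θ * (y - ρ))) ∂μ) ^ k := by
  induction k with
  | zero =>
    refine ⟨Measure.dirac 0, by simp [hν0], fun θ => ?_⟩
    rw [lintegral_dirac' _ (by fun_prop)]
    simp
  | succ k ih =>
    obtain ⟨m, hm, hmθ⟩ := ih
    refine ⟨m.conv μ, ?_, fun θ => ?_⟩
    · push_cast
      rw [hνsemi k (by positivity) 1 zero_le_one]
      exact conv_mono hm hμ
    · rw [Measure.lintegral_conv (by fun_prop), pow_succ, ← hmθ,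
        ← lintegral_mul_const _ (by fun_prop)]
      refine lintegral_congr fun x => ?_
      rw [← lintegral_const_mul _ (by fun_prop)]
      refine lintegral_congr fun y => ?_
      rw [← ENNReal.ofReal_mul (Real.exp_pos _).le, ← Real.exp_add]
      push_cast
      ring_nf

theorem exists_exp_lt_of_pow_le {h a b c γ : ℝ} (ha : 0 ≤ a) (hb : 0 ≤ b) (hah : a < h)
    (hbh : b < h) (hc : 0 < c) (hγ : Real.exp (-γ) < c * h) {P : ℕ → ℝ}
    (hP : ∀ k, h ^ k ≤ a ^ k + b ^ k + P k / c ^ k) :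
    ∃ k : ℕ, 1 ≤ k ∧ Real.exp (-(γ * k)) < P k := by
  have hh : 0 < h := ha.trans_lt hah
  have key : ∀ x, 0 ≤ x → x < h → ∀ᶠ k : ℕ in atTop, (x / h) ^ k < 1 / 4 := fun x hx hxh =>
    (tendsto_pow_atTop_nhds_zero_of_lt_one (by positivity) ((div_lt_one hh).2 hxh)).eventually
      (gt_mem_nhds (by norm_num))
  have hexp := (tendsto_pow_atTop_nhds_zero_of_lt_one (r := Real.exp (-γ) / (c * h))
    (by positivity) ((div_lt_one (by positivity)).2 hγ)).eventually
      (gt_mem_nhds (by norm_num : (0:ℝ) < 1 / 4))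
  obtain ⟨k, h1, h2, h3, hk⟩ :=
    ((key a ha hah).and ((key b hb hbh).and (hexp.and (eventually_ge_atTop 1)))).exists
  refine ⟨k, hk, ?_⟩
  have hhk : 0 < h ^ k := by positivity
  have hck : 0 < c ^ k := by positivity
  rw [div_pow, div_lt_iff₀ (by positivity)] at h1 h2 h3
  have e : Real.exp (-(γ * k)) = Real.exp (-γ) ^ k := by rw [← Real.exp_nat_mul]; ring_nf
  have hPk := hP k
  have h4 : h ^ k / 2 ≤ P k / c ^ k := by linarith
  rw [le_div_iff₀ hck] at h4
  rw [e]
  rw [mul_pow] at h3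
  nlinarith [mul_pos hhk hck]

/-- Splitting of the exponential moments of a `k`-fold convolution according to whether the
sum is below `r k`, above `(ρ + A) k`, or in between. -/
theorem mgf_pow_le_add {ν : ℝ → Measure ℝ} [∀ t, IsProbabilityMeasure (ν t)]
    (hν0 : ν 0 = Measure.dirac 0)
    (hνsemi : ∀ s ≥ (0:ℝ), ∀ t ≥ (0:ℝ), ν (s + t) = (ν s).conv (ν t))
    {μ : Measure ℝ} [IsFiniteMeasure μ] (hμ : μ ≤ ν 1) {ρ r θ δ₁ δ₂ A : ℝ} (hθ : 0 ≤ θ)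
    (hδ₁ : 0 < δ₁) (hδ₂ : 0 < δ₂) (hi : Integrable (fun y => Real.exp (θ * (y - ρ))) μ)
    (hi₁ : Integrable (fun y => Real.exp ((θ - δ₁) * (y - ρ))) μ)
    (hi₂ : Integrable (fun y => Real.exp ((θ + δ₂) * (y - ρ))) μ) (k : ℕ) :
    ProbabilityTheory.mgf (fun y => y - ρ) μ θ ^ k ≤
      (ProbabilityTheory.mgf (fun y => y - ρ) μ (θ - δ₁) * Real.exp (-(δ₁ * (ρ - r)))) ^ k +
      (ProbabilityTheory.mgf (fun y => y - ρ) μ (θ + δ₂) * Real.exp (-(δ₂ * A))) ^ k +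
      (ν k).real (Set.Ioi (r * k)) / Real.exp (-(θ * A)) ^ k := by
  obtain ⟨m, hm, hmθ⟩ := exists_convolution_powers hν0 hνsemi hμ ρ k
  have hval : ∀ s : ℝ, Integrable (fun y => Real.exp (s * (y - ρ))) μ →
      ∫⁻ y, ENNReal.ofReal (Real.exp (s * (y - k * ρ))) ∂m =
        ENNReal.ofReal (ProbabilityTheory.mgf (fun y => y - ρ) μ s ^ k) := by
    intro s hs
    rw [hmθ, ← ofReal_integral_eq_lintegral_ofReal hs (ae_of_all _ fun y => (Real.exp_pos _).le),
      ENNReal.ofReal_pow ProbabilityTheory.mgf_nonneg]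
    rfl
  set e₁ := Real.exp (-(δ₁ * (ρ - r))) ^ k with he₁
  set e₂ := Real.exp (-(δ₂ * A)) ^ k with he₂
  set e₃ := (Real.exp (-(θ * A)) ^ k)⁻¹ with he₃
  have hpt : ∀ y : ℝ, ENNReal.ofReal (Real.exp (θ * (y - k * ρ))) ≤
      ENNReal.ofReal e₁ * ENNReal.ofReal (Real.exp ((θ - δ₁) * (y - k * ρ))) +
      ENNReal.ofReal e₂ * ENNReal.ofReal (Real.exp ((θ + δ₂) * (y - k * ρ))) +
      (Set.Ioi (r * k)).indicator (fun _ => ENNReal.ofReal e₃) y := by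
    intro y
    rw [← ENNReal.ofReal_mul (by positivity), ← ENNReal.ofReal_mul (by positivity), he₁, he₂, he₃,
      ← Real.exp_nat_mul, ← Real.exp_nat_mul, ← Real.exp_nat_mul, ← Real.exp_neg, ← Real.exp_add,
      ← Real.exp_add]
    have hk : (0:ℝ) ≤ k := Nat.cast_nonneg k
    rcases le_or_gt y (r * k) with h1 | h1
    · refine le_trans (ENNReal.ofReal_le_ofReal (Real.exp_le_exp.2 ?_))
        (le_self_add.trans le_self_add)
      nlinarith
    rcases le_or_gt ((ρ + A) * k) y with h2 | h2
    · refine le_trans (ENNReal.ofReal_le_ofReal (Real.exp_le_exp.2 ?_))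
        (le_add_self.trans le_self_add)
      nlinarith
    · refine le_trans ?_ le_add_self
      rw [Set.indicator_of_mem (Set.mem_Ioi.2 h1)]
      refine ENNReal.ofReal_le_ofReal (Real.exp_le_exp.2 ?_)
      nlinarith
  have hintg := lintegral_mono (μ := m) hpt
  rw [lintegral_add_left (by fun_prop), lintegral_add_left (by fun_prop),
    lintegral_const_mul _ (by fun_prop), lintegral_const_mul _ (by fun_prop), hval _ hi,
    hval _ hi₁, hval _ hi₂, lintegral_indicator_const measurableSet_Ioi] at hintg
  have hintg2 := hintg.trans (add_le_add_right (mul_le_mul_right (hm (Set.Ioi (r * k))) _) _)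
  have hn : ∀ s : ℝ, 0 ≤ ProbabilityTheory.mgf (fun y => y - ρ) μ s :=
    fun s => ProbabilityTheory.mgf_nonneg
  have hn1 := hn (θ - δ₁)
  have hn2 := hn (θ + δ₂)
  rw [← ofReal_measureReal (by finiteness), ← ENNReal.ofReal_mul (by positivity),
    ← ENNReal.ofReal_mul (by positivity), ← ENNReal.ofReal_mul (by positivity),
    ← ENNReal.ofReal_add (by positivity) (by positivity),
    ← ENNReal.ofReal_add (by positivity) (by positivity),
    ENNReal.ofReal_le_ofReal_iff (by positivity)] at hintg2
  rw [mul_pow, mul_pow, div_eq_mul_inv]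
  linarith

/-- **Cramér's lower bound** in the form of a single scale: if the exponential moments of
`ν 1` centred at `ρ` stay above `exp (-γ)`, then some `ν k` charges `(r k, ∞)`, `r < ρ`, by
more than `exp (-γ k)`. -/
theorem exists_exp_lt_real_Ioi {ν : ℝ → Measure ℝ} [∀ t, IsProbabilityMeasure (ν t)]
    (hν0 : ν 0 = Measure.dirac 0)
    (hνsemi : ∀ s ≥ (0:ℝ), ∀ t ≥ (0:ℝ), ν (s + t) = (ν s).conv (ν t))
    {ε : ℝ} (hε0 : 0 < ε)
    (hε : ∀ θ : ℝ, |θ| < ε → Integrable (fun y => Real.exp (θ * y)) (ν 1)) {γ ρ r : ℝ}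
    (hr : r < ρ) (hpos : ν 1 (Set.Ioi ρ) ≠ 0)
    (hlt : ∀ θ ≥ (0:ℝ), Integrable (fun y => Real.exp (θ * (y - ρ))) (ν 1) →
      Real.exp (-γ) < ∫ y, Real.exp (θ * (y - ρ)) ∂(ν 1)) :
    ∃ k : ℕ, 1 ≤ k ∧ Real.exp (-(γ * k)) < (ν k).real (Set.Ioi (r * k)) := by
  obtain ⟨η, hη, K₀, hK₀⟩ := exists_Ioc_pos hpos
  obtain ⟨K, hKK₀, hK⟩ := exists_truncation_lt_mgf hε0 hε (Real.exp_pos (-γ)) hη hK₀ hlt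
  set μ := (ν 1).restrict (Set.Iic K) with hμ
  set h : ℝ → ℝ := ProbabilityTheory.mgf (fun y => y - ρ) μ with hh
  set p := (ν 1).real (Set.Ioc (ρ + η) K) with hp
  have hp0 : 0 < p := hK₀ K hKK₀
  have hle : ∀ θ ≥ (0:ℝ), p * Real.exp (θ * η) ≤ h θ := fun θ hθ =>
    le_mgf_restrict_Iic hε0 hε hθ
  have hdiff : ∀ θ > -ε, DifferentiableAt ℝ h θ := fun θ hθ =>
    differentiableAt_mgf_restrict_Iic hε K ρ hθ
  have hintg : ∀ θ > -ε, Integrable (fun y => Real.exp (θ * (y - ρ))) μ := fun θ hθ =>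
    integrable_exp_restrict_Iic hε K ρ hθ
  have hcont : ContinuousOn h (Set.Ici 0) := fun θ hθ =>
    (hdiff θ (by linarith [Set.mem_Ici.1 hθ])).continuousAt.continuousWithinAt
  have htend : Tendsto h atTop atTop := by
    refine tendsto_atTop_mono' atTop ((eventually_ge_atTop 0).mono hle) ?_
    exact (Real.tendsto_exp_atTop.comp (tendsto_id.atTop_mul_const hη)).const_mul_atTop hp0
  obtain ⟨θ, hθ0, hmin⟩ : ∃ θ ∈ Set.Ici (0:ℝ), IsMinOn h (Set.Ici 0) θ := by
    refine hcont.exists_isMinOn' isClosed_Ici Set.self_mem_Ici ?_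
    obtain ⟨B, hB⟩ := (htend.eventually_ge_atTop (h 0)).exists_forall_of_atTop
    rw [eventually_inf_principal]
    filter_upwards [(isCompact_Icc (a := (0:ℝ)) (b := max B 0)).compl_mem_cocompact] with x hx hx0
    refine hB x ?_
    by_contra hlt
    exact hx ⟨hx0, le_max_of_le_left (not_le.1 hlt).le⟩
  rw [Set.mem_Ici] at hθ0
  have hθε : -ε < θ := by linarith
  have hhθ : Real.exp (-γ) < h θ := hK θ hθ0
  have hhpos : 0 < h θ := (Real.exp_pos _).trans hhθ
  have hd := (hdiff θ hθε).hasDerivAt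
  set d := deriv h θ with hd'
  have hdnn : 0 ≤ d := by
    by_contra! hneg
    obtain ⟨δ, hδ, hδlt⟩ := exists_lt_of_hasDerivAt_neg (g := fun δ => h (θ + δ)) (d := d)
      (by simpa using HasDerivAt.comp_const_add θ 0 (by simpa using hd)) hneg zero_lt_one
    have := hmin (Set.mem_Ici.2 (by linarith [hδ.1] : 0 ≤ θ + δ))
    simp only [add_zero] at hδlt
    exact absurd this (not_le.2 hδlt)
  obtain ⟨δ₁, hδ₁, h1⟩ := exists_lt_of_hasDerivAt_neg
    (g := fun δ => h (θ - δ) * Real.exp (-(δ * (ρ - r)))) (d := -d - h θ * (ρ - r))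
    (by
      have e1 : HasDerivAt (fun δ => h (θ - δ)) (-d) 0 :=
        HasDerivAt.comp_const_sub θ 0 (by simpa using hd)
      have e2 : HasDerivAt (fun δ : ℝ => Real.exp (-(δ * (ρ - r)))) (-(ρ - r)) 0 := by
        simpa using ((hasDerivAt_id (0:ℝ)).mul_const (ρ - r)).neg.exp
      refine (e1.mul e2).congr_deriv ?_
      simp; ring) (by nlinarith) (by linarith : 0 < θ + ε)
  obtain ⟨A, δ₂, hδ₂, hA, h2⟩ : ∃ A δ₂ : ℝ, 0 < δ₂ ∧ Real.exp (-γ) < Real.exp (-(θ * A)) * h θ ∧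
      h (θ + δ₂) * Real.exp (-(δ₂ * A)) < h θ := by
    rcases hθ0.eq_or_lt with h0 | h0
    · have : Tendsto (fun A : ℝ => h (θ + 1) * Real.exp (-(1 * A))) atTop (nhds 0) := by
        have := (Real.tendsto_exp_neg_atTop_nhds_zero).const_mul (h (θ + 1))
        simpa using this
      obtain ⟨A, hA⟩ := (this.eventually (gt_mem_nhds hhpos)).exists
      exact ⟨A, 1, one_pos, by simpa [← h0] using hhθ, hA⟩
    · have hc : Tendsto (fun A : ℝ => Real.exp (-(θ * A)) * h θ) (nhdsWithin 0 (Set.Ioi 0))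
          (nhds (h θ)) := by
        have : Continuous fun A : ℝ => Real.exp (-(θ * A)) * h θ := by fun_prop
        simpa using (this.tendsto 0).mono_left nhdsWithin_le_nhds
      obtain ⟨A, hA, hA0⟩ := ((hc.eventually (lt_mem_nhds hhθ)).and self_mem_nhdsWithin).exists
      have hd0 : d = 0 := IsLocalMin.deriv_eq_zero (hmin.isLocalMin (Ici_mem_nhds h0))
      obtain ⟨δ, hδ, hlt⟩ := exists_lt_of_hasDerivAt_neg
        (g := fun δ => h (θ + δ) * Real.exp (-(δ * A))) (d := d - h θ * A)
        (by
          have e1 : HasDerivAt (fun δ => h (θ + δ)) d 0 :=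
            HasDerivAt.comp_const_add θ 0 (by simpa using hd)
          have e2 : HasDerivAt (fun δ : ℝ => Real.exp (-(δ * A))) (-A) 0 := by
            simpa using ((hasDerivAt_id (0:ℝ)).mul_const A).neg.exp
          refine (e1.mul e2).congr_deriv ?_
          simp; ring) (by nlinarith [mul_pos hhpos (show 0 < A from hA0)]) zero_lt_one
      exact ⟨A, δ, hδ.1, hA, by simpa using hlt⟩
  refine exists_exp_lt_of_pow_le (mul_nonneg ProbabilityTheory.mgf_nonneg (Real.exp_pos _).le)
    (mul_nonneg ProbabilityTheory.mgf_nonneg (Real.exp_pos _).le) (by simpa using h1) h2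
    (Real.exp_pos (-(θ * A))) hA fun k => ?_
  exact mgf_pow_le_add hν0 hνsemi Measure.restrict_le_self hθ0 hδ₁.1 hδ₂ (hintg _ hθε)
    (hintg _ (by linarith [hδ₁.2])) (hintg _ (by linarith)) k

/-- The values `(Λ(θ) + γ) / θ`, `θ > 0`, are bounded below by the mean. -/
theorem integral_id_le_div {μ : Measure ℝ} [IsProbabilityMeasure μ] {ε : ℝ} (hε0 : 0 < ε)
    (hε : ∀ θ : ℝ, |θ| < ε → Integrable (fun y => Real.exp (θ * y)) μ) {γ θ : ℝ} (hγ : 0 ≤ γ)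
    (hθ : 0 < θ) (hi : Integrable (fun y => Real.exp (θ * y)) μ) :
    ∫ y, y ∂μ ≤ (Real.log (∫ y, Real.exp (θ * y) ∂μ) + γ) / θ := by
  have hid : Integrable (fun y : ℝ => y) μ := by
    have h0 : |ε / 2| < ε := by rw [abs_of_pos (by linarith)]; linarith
    have h := ProbabilityTheory.integrable_pow_abs_of_integrable_exp_mul (X := id)
      (by positivity : ε / 2 ≠ 0) (hε _ h0) (hε (-(ε / 2)) (by rwa [abs_neg])) 1
    exact (integrable_norm_iff (by fun_prop)).1 (by simpa using h)
  set m := ∫ y, y ∂μ with hm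
  have hlin : Integrable (fun y => θ * (y - m)) μ :=
    (hid.sub (integrable_const m)).const_mul θ
  have h1 : ∫ y, Real.exp (θ * m) * (1 + θ * (y - m)) ∂μ ≤ ∫ y, Real.exp (θ * y) ∂μ := by
    refine integral_mono (((integrable_const 1).add hlin).const_mul _) hi fun y => ?_
    have h := Real.add_one_le_exp (θ * (y - m))
    have e : Real.exp (θ * y) = Real.exp (θ * m) * Real.exp (θ * (y - m)) := by
      rw [← Real.exp_add]; ring_nf
    rw [e]
    exact mul_le_mul_of_nonneg_left (by linarith) (Real.exp_pos _).le
  have h2 : ∫ y, Real.exp (θ * m) * (1 + θ * (y - m)) ∂μ = Real.exp (θ * m) := by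
    rw [integral_const_mul, integral_add (integrable_const 1) hlin, integral_const_mul,
      integral_sub hid (by fun_prop)]
    simp [← hm]
  rw [h2] at h1
  have h3 := Real.log_le_log (Real.exp_pos _) h1
  rw [Real.log_exp] at h3
  rw [le_div_iff₀ hθ]
  linarith

/-- Below the front speed, the convolution powers of `ν 1` beat the decay `exp (-γ k)`. -/
theorem exists_exp_lt_of_lt_speed {ν : ℝ → Measure ℝ} [∀ t, IsProbabilityMeasure (ν t)]
    (hν0 : ν 0 = Measure.dirac 0)
    (hνsemi : ∀ s ≥ (0:ℝ), ∀ t ≥ (0:ℝ), ν (s + t) = (ν s).conv (ν t))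
    {ε : ℝ} (hε0 : 0 < ε)
    (hε : ∀ θ : ℝ, |θ| < ε → Integrable (fun y => Real.exp (θ * y)) (ν 1)) {γ q r : ℝ}
    (hγ : 0 < γ) (hr : r < q)
    (hq : ∀ θ > (0:ℝ), Integrable (fun y => Real.exp (θ * y)) (ν 1) →
      q ≤ (Real.log (∫ y, Real.exp (θ * y) ∂(ν 1)) + γ) / θ) :
    ∃ k : ℕ, 1 ≤ k ∧ Real.exp (-(γ * k)) < (ν k).real (Set.Ioi (r * k)) := by
  obtain ⟨ρ, hrρ, hρq⟩ := exists_between hr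
  refine exists_exp_lt_real_Ioi hν0 hνsemi hε0 hε hrρ ?_ ?_
  · intro h0
    have hae : ∀ᵐ y ∂(ν 1), y ≤ ρ := by
      rw [ae_iff]; simpa [Set.Ioi] using h0
    set θ := 2 * γ / (q - ρ) with hθ
    have hqρ : 0 < q - ρ := by linarith
    have hθ0 : 0 < θ := by positivity
    have hb : ∀ᵐ y ∂(ν 1), Real.exp (θ * y) ≤ Real.exp (θ * ρ) := by
      filter_upwards [hae] with y hy
      exact Real.exp_le_exp.2 (mul_le_mul_of_nonneg_left hy hθ0.le)
    have hi : Integrable (fun y => Real.exp (θ * y)) (ν 1) :=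
      Integrable.of_bound (by fun_prop) (Real.exp (θ * ρ))
        (hb.mono fun y hy => by rwa [Real.norm_eq_abs, Real.abs_exp])
    have h1 : ∫ y, Real.exp (θ * y) ∂(ν 1) ≤ Real.exp (θ * ρ) := by
      simpa using integral_mono_ae hi (integrable_const _) hb
    have h2 := Real.log_le_log (integral_exp_pos hi) h1
    rw [Real.log_exp] at h2
    have h3 := hq θ hθ0 hi
    rw [le_div_iff₀ hθ0] at h3
    have h4 : (q - ρ) * θ = 2 * γ := by rw [hθ]; field_simp
    linarith
  · intro θ hθ hi
    rcases hθ.eq_or_lt with h0 | h0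
    · simp [← h0, hγ]
    · have e : ∀ y, Real.exp (θ * (y - ρ)) = Real.exp (-(θ * ρ)) * Real.exp (θ * y) := fun y => by
        rw [← Real.exp_add]; ring_nf
      simp_rw [e] at hi ⊢
      have hi' : Integrable (fun y => Real.exp (θ * y)) (ν 1) :=
        (integrable_const_mul_iff (Real.exp_pos _).ne'.isUnit _).1 hi
      rw [integral_const_mul]
      have h1 := hq θ h0 hi'
      rw [le_div_iff₀ h0] at h1
      have h2 : Real.exp (q * θ - γ) ≤ ∫ y, Real.exp (θ * y) ∂(ν 1) := by
        rw [← Real.le_log_iff_exp_le (integral_exp_pos hi')]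
        linarith
      calc Real.exp (-γ) < Real.exp (-(θ * ρ)) * Real.exp (q * θ - γ) := by
            rw [← Real.exp_add]
            exact Real.exp_lt_exp.2 (by nlinarith)
        _ ≤ _ := mul_le_mul_of_nonneg_left h2 (Real.exp_pos _).le

theorem ConvexOn.add_mul_sub_le {S : Set ℝ} {f : ℝ → ℝ} {d x v : ℝ} (hf : ConvexOn ℝ S f)
    (hx : x ∈ S) (hd : HasDerivWithinAt f d S x) (hv : v ∈ S) : f x + d * (v - x) ≤ f v := by
  rcases lt_trichotomy x v with h | h | h
  · have := hf.le_slope_of_hasDerivWithinAt hx hv h hd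
    rw [slope_def_field, le_div_iff₀ (by linarith)] at this
    linarith
  · simp [h]
  · have := hf.slope_le_of_hasDerivWithinAt hv hx h hd
    rw [slope_def_field, div_le_iff₀ (by linarith)] at this
    linarith

theorem exists_le_neg_mul_of_lt_deriv {f : ℝ → ℝ} {γ κ a : ℝ} (hf1 : f 1 = 0)
    (hγ : HasDerivWithinAt f γ (Set.Icc 0 1) 1) (hκ : κ < γ) (ha : a < 1) :
    ∃ y ∈ Set.Ioo a 1, f y ≤ -(κ * (1 - y)) := by
  have hmem : Set.Icc (0:ℝ) 1 ∈ nhdsWithin 1 (Set.Iio 1) := Icc_mem_nhdsLT zero_lt_one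
  have h := hγ.mono_of_mem_nhdsWithin hmem
  rw [hasDerivWithinAt_iff_tendsto_slope' Set.self_notMem_Iio] at h
  obtain ⟨y, hy, hya⟩ := ((h.eventually (lt_mem_nhds hκ)).and (Ioo_mem_nhdsLT ha)).exists
  refine ⟨y, hya, ?_⟩
  rw [slope_def_field, lt_div_iff_of_neg (by linarith [hya.2]), hf1] at hy
  linarith

theorem neg_of_root_lt {f : ℝ → ℝ} {γ α a : ℝ} (hfconv : ConvexOn ℝ (Set.Icc 0 1) f)
    (hf1 : f 1 = 0) (hγ : HasDerivWithinAt f γ (Set.Icc 0 1) 1) (hγpos : 0 < γ) (hα : 0 ≤ α)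
    (hαroot : f α = 0) (ha : a ∈ Set.Ioo α 1) : f a < 0 := by
  obtain ⟨y, hy, hfy⟩ := exists_le_neg_mul_of_lt_deriv hf1 hγ (half_lt_self hγpos) ha.2
  have hfy0 : f y < 0 := hfy.trans_lt (by nlinarith [hy.2])
  have h := hfconv.slope_mono_adjacent (x := α) (y := a) (z := y)
    ⟨hα, by linarith [ha.1, ha.2]⟩ ⟨by linarith [ha.1, hy.1], hy.2.le⟩ ha.1 hy.1
  rw [hαroot, div_le_div_iff₀ (by linarith [ha.1]) (by linarith [hy.1])] at h
  nlinarith [ha.1, hy.1]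

namespace IsUnitMildSolution

variable {ν : ℝ → Measure ℝ} {f : ℝ → ℝ} {u : ℝ → ℝ → ℝ}

/-- Beyond a speed `(Λ(θ) + γ) / θ` the solution converges to `1`. -/
theorem tendsto_one [∀ t, IsProbabilityMeasure (ν t)] (hS : IsUnitMildSolution ν f u) {γ : ℝ}
    (hf : ∀ v ∈ Set.Icc (0:ℝ) 1, -γ * (1 - v) ≤ f v) {θ r : ℝ} (hθ : 0 < θ)
    (hi : Integrable (fun y => Real.exp (θ * y)) (ν 1))
    (hr : (Real.log (∫ y, Real.exp (θ * y) ∂(ν 1)) + γ) / θ < r) :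
    Tendsto (fun t => u t (r * t)) atTop (nhds 1) := by
  set Λ := Real.log (∫ y, Real.exp (θ * y) ∂(ν 1)) with hΛ
  rw [div_lt_iff₀ hθ] at hr
  have hlow : ∀ t ≥ (0:ℝ), 1 - Real.exp (-((r * θ - Λ - γ) * t)) ≤ u t (r * t) := by
    intro t ht
    have h1 := hS.sub_le_of_affine_le hf ht (r * t)
    obtain ⟨hit, hval⟩ := integral_exp_semigroup hS.semi hS.meas hi ht
    have h2 := ProbabilityTheory.measure_ge_le_exp_mul_mgf (X := id) (μ := ν t) (r * t) hθ.le hit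
    have h3 : 1 - (ν t).real (Set.Iic (r * t)) ≤
        Real.exp (-θ * (r * t)) * Real.exp (t * Λ) := by
      rw [← hval, ← probReal_compl_eq_one_sub measurableSet_Iic, Set.compl_Iic]
      exact (measureReal_mono fun y hy => (Set.mem_Ioi.1 hy).le).trans h2
    have h4 := mul_le_mul_of_nonneg_left h3 (Real.exp_pos (-(-γ * t))).le
    rw [← Real.exp_add, ← Real.exp_add] at h4
    have e : -(-γ * t) + (-θ * (r * t) + t * Λ) = -((r * θ - Λ - γ) * t) := by ring
    rw [e] at h4
    linarith
  have htend : Tendsto (fun t => 1 - Real.exp (-((r * θ - Λ - γ) * t))) atTop (nhds 1) := by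
    have := (Real.tendsto_exp_neg_atTop_nhds_zero.comp
      (tendsto_id.const_mul_atTop (by linarith : 0 < r * θ - Λ - γ))).const_sub 1
    simpa using this
  refine tendsto_of_tendsto_of_tendsto_of_le_of_le' htend tendsto_const_nhds ?_ ?_
  · filter_upwards [eventually_ge_atTop 0] with t ht using hlow t ht
  · filter_upwards [eventually_ge_atTop 0] with t ht using (hS.mem t ht _).2

/-- The solution is asymptotically at least the smaller root `α`. -/
theorem eventually_lt [∀ t, IsProbabilityMeasure (ν t)] (hS : IsUnitMildSolution ν f u) {κ α : ℝ}
    (hκ : 0 < κ) (hf : ∀ v ∈ Set.Icc (0:ℝ) 1, κ * (α - v) ≤ f v) (r : ℝ) {c : ℝ} (hc : c < α) :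
    ∀ᶠ t in atTop, c < u t (r * t) := by
  have htend : Tendsto (fun t => Real.exp (-(κ * t)) * α) atTop (nhds 0) := by
    have := (Real.tendsto_exp_neg_atTop_nhds_zero.comp (tendsto_id.const_mul_atTop hκ)).mul_const α
    simpa using this
  filter_upwards [htend.eventually (gt_mem_nhds (sub_pos.2 hc)), eventually_ge_atTop 0]
    with t h1 ht
  have h2 := hS.sub_le_of_affine_le hf ht (r * t)
  have h3 : 0 ≤ Real.exp (-(κ * t)) * (ν t).real (Set.Iic (r * t)) := by positivity
  rw [mul_sub] at h2
  linarith

/-- Along a moving frame in which `ν k` is large enough, the solution stays uniformly away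
from `1` at the times `n k`. -/
theorem exists_le_one_sub [∀ t, IsProbabilityMeasure (ν t)] (hS : IsUnitMildSolution ν f u)
    (hconv : ConvexOn ℝ (Set.Icc 0 1) f) (hf1 : f 1 = 0) {L : ℝ} (hL : 0 < L)
    (hLip : ∀ v ∈ Set.Icc (0:ℝ) 1, ∀ w ∈ Set.Icc (0:ℝ) 1, |f v - f w| ≤ L * |v - w|) {γ : ℝ}
    (hγ : HasDerivWithinAt f γ (Set.Icc 0 1) 1) (hγpos : 0 < γ) {r : ℝ} {k : ℕ} (hk : 1 ≤ k)
    (hP : Real.exp (-(γ * k)) < (ν k).real (Set.Ioi (r * k))) :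
    ∃ δ > 0, ∀ n : ℕ, ∀ x < n * k * r, u (n * k) x ≤ 1 - δ := by
  set P := (ν k).real (Set.Ioi (r * k)) with hPdef
  have hk0 : (0:ℝ) < k := by exact_mod_cast hk
  have hP0 : 0 < P := (Real.exp_pos _).trans hP
  obtain ⟨κ, hκ0, hκγ, hκP⟩ : ∃ κ : ℝ, 0 ≤ κ ∧ κ < γ ∧ Real.exp (-(κ * k)) ≤ P := by
    refine ⟨max 0 (-Real.log P / k), le_max_left _ _, max_lt hγpos ?_, ?_⟩
    · rw [div_lt_iff₀ hk0]
      linarith [(Real.lt_log_iff_exp_lt hP0).2 hP]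
    · rw [← Real.le_log_iff_exp_le hP0]
      have := mul_le_mul_of_nonneg_right (le_max_right 0 (-Real.log P / k)) hk0.le
      rw [div_mul_cancel₀ _ hk0.ne'] at this
      linarith
  obtain ⟨y, hy, hfy⟩ := exists_le_neg_mul_of_lt_deriv hf1 hγ hκγ zero_lt_one
  have hb0 : 0 < 1 - y := by linarith [hy.2]
  refine ⟨(1 - y) * Real.exp (-(κ * k)), by positivity, fun n => ?_⟩
  induction n with
  | zero =>
    intro x hx
    have hx0 : ¬ (0 ≤ x) := not_le.2 (by simpa using hx)
    have hu0 : u 0 x = 0 := by rw [hS.sol.2.1 x]; simp [hx0]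
    rw [Nat.cast_zero, zero_mul, hu0]
    have : Real.exp (-(κ * k)) ≤ 1 := Real.exp_le_one_iff.2 (by nlinarith)
    nlinarith [hy.1]
  | succ n ih =>
    intro x hx
    have h := hS.le_one_sub_of_initial_le hconv hf1 hL hLip hb0 (by linarith [hy.1]) hκ0
      (by rwa [sub_sub_cancel]) (by positivity : (0:ℝ) ≤ n * k) hk0.le ih x
    have e : (n:ℝ) * k + k = (n + 1 : ℕ) * k := by push_cast; ring
    rw [e] at h
    have hmono : P ≤ (ν k).real (Set.Ioi (x - n * k * r)) := by
      refine measureReal_mono (Set.Ioi_subset_Ioi ?_)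
      push_cast at hx
      linarith
    have := mul_le_mul_of_nonneg_left (hκP.trans hmono) hb0.le
    linarith

theorem eventually_gt [∀ t, IsProbabilityMeasure (ν t)] (hS : IsUnitMildSolution ν f u)
    (hconv : ConvexOn ℝ (Set.Icc 0 1) f) (hf1 : f 1 = 0) {L : ℝ} (hL : 0 < L)
    (hLip : ∀ v ∈ Set.Icc (0:ℝ) 1, ∀ w ∈ Set.Icc (0:ℝ) 1, |f v - f w| ≤ L * |v - w|) {γ : ℝ}
    (hγ : HasDerivWithinAt f γ (Set.Icc 0 1) 1) (hγpos : 0 < γ) {r r' : ℝ} (hr : r < r') {k : ℕ}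
    (hk : 1 ≤ k) (hP : Real.exp (-(γ * k)) < (ν k).real (Set.Ioi (r' * k))) {θ : ℝ} (hθ : 0 < θ)
    (hi : Integrable (fun y => Real.exp (-θ * y)) (ν 1)) {a c : ℝ} (ha : a ∈ Set.Ico (0:ℝ) 1)
    (hfa : f a < 0) (hac : a < c) : ∀ᶠ t in atTop, u t (r * t) < c := by
  obtain ⟨δ, hδ, hstart⟩ := hS.exists_le_one_sub hconv hf1 hL hLip hγ hγpos hk hP
  have hk0 : (0:ℝ) < k := by exact_mod_cast hk
  set b := 1 - a with hb
  have hb0 : 0 < b := by linarith [ha.2]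
  set κ := -f a / b with hκ
  have hκ0 : 0 < κ := div_pos (by linarith) hb0
  have hfb : f (1 - b) ≤ -(κ * b) := by
    rw [hκ, div_mul_cancel₀ _ hb0.ne', hb, sub_sub_cancel, neg_neg]
  obtain ⟨m, hm, hm0⟩ : ∃ m : ℝ, (∀ s ≥ m, b * Real.exp (-(κ * s)) ≤ δ) ∧ 0 ≤ m := by
    have : Tendsto (fun s => b * Real.exp (-(κ * s))) atTop (nhds 0) := by
      have := (Real.tendsto_exp_neg_atTop_nhds_zero.comp
        (tendsto_id.const_mul_atTop hκ0)).const_mul b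
      simpa using this
    obtain ⟨m, hm⟩ := (this.eventually (ge_mem_nhds hδ)).exists_forall_of_atTop
    exact ⟨max m 0, fun s hs => hm s (le_of_max_le_left hs), le_max_right _ _⟩
  set Λ := Real.log (∫ y, Real.exp (-θ * y) ∂(ν 1)) with hΛ
  set A : ℝ → ℝ := fun t => (r' - r) * (t - m - k) - |r| * (m + k) with hA
  have hAtend : Tendsto A atTop atTop := by
    have h1 : Tendsto (fun t : ℝ => (r' - r) * t) atTop atTop :=
      tendsto_id.const_mul_atTop (sub_pos.2 hr)
    refine (tendsto_atTop_add_const_right _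
      (-((r' - r) * (m + k)) - |r| * (m + k)) h1).congr fun t => ?_
    simp only [hA]; ring
  have htend : Tendsto (fun t => 1 - b * (1 - Real.exp (-(θ * A t)) * Real.exp ((m + k) * |Λ|)))
      atTop (nhds a) := by
    have := ((((Real.tendsto_exp_neg_atTop_nhds_zero.comp (hAtend.const_mul_atTop hθ)).mul_const
      (Real.exp ((m + k) * |Λ|))).const_sub 1).const_mul b).const_sub 1
    simpa [hb] using this
  filter_upwards [htend.eventually (gt_mem_nhds hac), eventually_ge_atTop m] with t hct htm
  refine lt_of_le_of_lt ?_ hct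
  set n := ⌊(t - m) / k⌋₊ with hn
  have hnle : n * (k:ℝ) ≤ t - m := by
    rw [← le_div_iff₀ hk0]
    exact Nat.floor_le (div_nonneg (by linarith) hk0.le)
  have hnlt : t - m < (n + 1) * (k:ℝ) := by
    rw [← div_lt_iff₀ hk0]
    exact Nat.lt_floor_add_one _
  set s := t - n * k with hs
  have hsm : m ≤ s := by linarith
  have hsk : s ≤ m + k := by linarith
  have hs0 : 0 ≤ s := hm0.trans hsm
  have h := hS.le_one_sub_of_initial_le hconv hf1 hL hLip hb0 (by linarith [ha.1]) hκ0.le hfb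
    (by positivity : (0:ℝ) ≤ n * k) hs0
    (fun x hx => (hstart n x hx).trans (by linarith [hm s hsm])) (r * t)
  rw [show (n:ℝ) * k + s = t by rw [hs]; ring] at h
  refine h.trans (sub_le_sub_left (mul_le_mul_of_nonneg_left ?_ hb0.le) _)
  have hx : r * t - n * k * r' ≤ -A t := by
    have h1 : r * s ≤ |r| * (m + k) :=
      (mul_le_mul_of_nonneg_right (le_abs_self r) hs0).trans
        (mul_le_mul_of_nonneg_left hsk (abs_nonneg r))
    have h2 : (r' - r) * (t - m - k) ≤ (r' - r) * (n * k) :=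
      mul_le_mul_of_nonneg_left (by linarith) (by linarith)
    have h3 : r * t = r * s + r * (n * k) := by rw [hs]; ring
    simp only [hA]
    linarith
  obtain ⟨his, hval⟩ := integral_exp_semigroup hS.semi hS.meas hi hs0
  have hch := ProbabilityTheory.measure_le_le_exp_mul_mgf (X := id) (μ := ν s) (-A t)
    (by linarith : -θ ≤ 0) his
  have hmgf : ProbabilityTheory.mgf id (ν s) (-θ) ≤ Real.exp ((m + k) * |Λ|) := by
    refine (le_of_eq hval).trans (Real.exp_le_exp.2 ?_)
    exact (mul_le_mul_of_nonneg_left (le_abs_self _) hs0).trans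
      (mul_le_mul_of_nonneg_right hsk (abs_nonneg _))
  have hIic : (ν s).real (Set.Iic (r * t - n * k * r')) ≤
      Real.exp (-(θ * A t)) * Real.exp ((m + k) * |Λ|) := by
    refine (measureReal_mono fun y hy => ?_).trans (hch.trans ?_)
    · exact (Set.mem_Iic.1 hy).trans hx
    · rw [show -(-θ) * -A t = -(θ * A t) by ring]
      exact mul_le_mul_of_nonneg_left hmgf (Real.exp_pos _).le
  rw [← Set.compl_Iic, probReal_compl_eq_one_sub measurableSet_Iic]
  linarith

end IsUnitMildSolution

/-- wavefront propagation, Proposition 5.2.  Let `u` be the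
`[0,1]`-valued mild solution of `∂u/∂t = 𝓛u + f(u)` with Heaviside initial condition,
where `f` is convex, differentiable and Lipschitz on `[0,1]` with `f(0) ≥ 0`, `f(1) = 0`,
`f'(1) = γ > 0` and smaller root `α ∈ [0,1)`, and `ν₁` is not a Dirac mass.  With
`q = inf_{θ>0, Λ(θ)<∞} (Λ(θ)+γ)/θ` for the cumulant generating function `Λ` of the Lévy
process, `u(t, rt) → α` if `r < q` and `u(t, rt) → 1` if `r > q`, as `t → ∞`. -/
theorem mild_solution_wavefront
    (ν : ℝ → Measure ℝ) [∀ t, IsProbabilityMeasure (ν t)]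
    (hν0 : ν 0 = Measure.dirac 0)
    (hνsemi : ∀ s ≥ (0:ℝ), ∀ t ≥ (0:ℝ), ν (s + t) = (ν s).conv (ν t))
    (hνmeas : Measurable ν)
    (hνdirac : ∀ c : ℝ, ν 1 ≠ Measure.dirac c)
    -- the cumulant generating function `Λ` is finite in a neighbourhood of `0`:
    (hΛfin : ∃ ε > (0:ℝ), ∀ θ : ℝ, |θ| < ε →
      Integrable (fun y => Real.exp (θ * y)) (ν 1))
    (f : ℝ → ℝ)
    (hfconv : ConvexOn ℝ (Set.Icc 0 1) f)
    (hfdiff : DifferentiableOn ℝ f (Set.Icc 0 1))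
    (hfLip : ∃ L : NNReal, LipschitzOnWith L f (Set.Icc 0 1))
    (hf0 : 0 ≤ f 0) (hf1 : f 1 = 0)
    (γ : ℝ) (hγ : HasDerivWithinAt f γ (Set.Icc 0 1) 1) (hγpos : 0 < γ)
    (α : ℝ) (hα : α ∈ Set.Ico (0:ℝ) 1) (hαroot : f α = 0)
    (hαmin : ∀ v ∈ Set.Icc (0:ℝ) 1, f v = 0 → α ≤ v)
    (u : ℝ → ℝ → ℝ)
    (hu : IsMildSolutionConv ν f (fun x => if 0 ≤ x then (1:ℝ) else 0) u)
    (hu01 : ∀ t ≥ (0:ℝ), ∀ x, u t x ∈ Set.Icc (0:ℝ) 1)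
    (q : ℝ)
    (hq : q = sInf {c : ℝ | ∃ θ > (0:ℝ),
      Integrable (fun y => Real.exp (θ * y)) (ν 1) ∧
      c = (Real.log (∫ y, Real.exp (θ * y) ∂(ν 1)) + γ) / θ})
    (r : ℝ) :
    (r < q → Tendsto (fun t => u t (r * t)) atTop (nhds α)) ∧
    (q < r → Tendsto (fun t => u t (r * t)) atTop (nhds 1)) := by
  obtain ⟨ε, hε0, hε⟩ := hΛfin
  obtain ⟨L, hL⟩ := hfLip
  have hS : IsUnitMildSolution ν f u := ⟨hν0, hνsemi, hνmeas, hfdiff.continuousOn, hu, hu01⟩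
  have hε2 : |ε / 2| < ε := by rw [abs_of_pos (by linarith)]; linarith
  set S : Set ℝ := {c : ℝ | ∃ θ > (0:ℝ), Integrable (fun y => Real.exp (θ * y)) (ν 1) ∧
    c = (Real.log (∫ y, Real.exp (θ * y) ∂(ν 1)) + γ) / θ} with hSdef
  have hSbdd : BddBelow S := by
    refine ⟨∫ y, y ∂(ν 1), ?_⟩
    rintro c ⟨θ, hθ, hi, rfl⟩
    exact integral_id_le_div hε0 hε hγpos.le hθ hi
  have hSne : S.Nonempty := ⟨_, ε / 2, by positivity, hε _ hε2, rfl⟩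
  have h1mem : (1:ℝ) ∈ Set.Icc (0:ℝ) 1 := ⟨zero_le_one, le_rfl⟩
  refine ⟨fun hr => ?_, fun hr => ?_⟩
  · have hLip : ∀ v ∈ Set.Icc (0:ℝ) 1, ∀ w ∈ Set.Icc (0:ℝ) 1,
        |f v - f w| ≤ ((L : ℝ) + 1) * |v - w| := by
      intro v hv w hw
      have h := hL.dist_le_mul v hv w hw
      rw [Real.dist_eq, Real.dist_eq] at h
      linarith [abs_nonneg (v - w)]
    obtain ⟨r', hrr', hr'q⟩ := exists_between hr
    obtain ⟨k, hk, hP⟩ := exists_exp_lt_of_lt_speed hν0 hνsemi hε0 hε hγpos hr'q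
      fun θ hθ hi => hq ▸ csInf_le hSbdd ⟨θ, hθ, hi, rfl⟩
    have hneg : ∀ a ∈ Set.Ioo α 1, f a < 0 := fun a ha =>
      neg_of_root_lt hfconv hf1 hγ hγpos hα.1 hαroot ha
    refine tendsto_order.2 ⟨fun c hc => ?_, fun c hc => ?_⟩
    · rcases hα.1.eq_or_lt with h0 | h0
      · filter_upwards [eventually_ge_atTop 0] with t ht
        exact (h0 ▸ hc).trans_le (hu01 t ht _).1
      · have hαmem : α ∈ Set.Icc (0:ℝ) 1 := ⟨hα.1, hα.2.le⟩
        have htan : ∀ v ∈ Set.Icc (0:ℝ) 1, f α + derivWithin f (Set.Icc 0 1) α * (v - α) ≤ f v :=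
          fun v hv => hfconv.add_mul_sub_le hαmem (hfdiff α hαmem).hasDerivWithinAt hv
        obtain ⟨a, ha⟩ := exists_between hα.2
        refine hS.eventually_lt (κ := -derivWithin f (Set.Icc 0 1) α) ?_ (fun v hv => ?_) r hc
        · have h := htan a ⟨by linarith [ha.1], ha.2.le⟩
          have := hneg a ha
          rw [hαroot] at h
          by_contra! hcon
          nlinarith [ha.1]
        · have h := htan v hv
          rw [hαroot] at h
          linarith
    · obtain ⟨a, haα, ha⟩ := exists_between (lt_min hc hα.2)
      have ha1 : a < 1 := ha.trans_le (min_le_right _ _)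
      exact hS.eventually_gt hfconv hf1 (by positivity) hLip hγ hγpos hrr' hk hP
        (θ := ε / 2) (by positivity) (hε _ (by rwa [abs_neg])) ⟨hα.1.trans haα.le, ha1⟩
        (hneg a ⟨haα, ha1⟩) (ha.trans_le (min_le_left _ _))
  · rw [hq] at hr
    obtain ⟨c, ⟨θ, hθ, hi, rfl⟩, hcr⟩ := exists_lt_of_csInf_lt hSne hr
    refine hS.tendsto_one (γ := γ) (fun v hv => ?_) hθ hi hcr
    have h := hfconv.add_mul_sub_le h1mem hγ hv
    rw [hf1] at h
    linarith
end

section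
/- Let g : ℝ → ℝ be continuous and concave on [0,β] with g(0) = 0, g(s) > 0 for all s ∈ (0,β), and g differentiable at 0 with g'(0) = γ > 0. Then for every c with 0 < c < γ and every b with 0 < b < β, there exists δ* > 0 such that for all δ ≥ δ*: ∫_{b e^{−cδ}}^{b} ds / g(s) ≤ δ. (Equivalently, the backward flow of the ODE dq/dt = g(q) satisfies Q_δ^{-1}(b) ≤ b e^{−cδ} for all δ ≥ δ*.) -/
open MeasureTheory intervalIntegral

/-- A function with one-sided derivative exceeding `m` at a zero `0` dominates `m * s` near `0`. -/
theorem HasDerivWithinAt.exists_forall_mul_le_of_lt {g : ℝ → ℝ} {γ m β : ℝ} (hg0 : g 0 = 0)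
    (hg : HasDerivWithinAt g γ (Set.Icc 0 β) 0) (hm : m < γ) :
    ∃ ε > (0 : ℝ), ∀ s, 0 < s → s < ε → s ≤ β → m * s ≤ g s := by
  have h := (hasDerivWithinAt_iff_tendsto_slope.1 hg).eventually (lt_mem_nhds hm)
  obtain ⟨ε, hε, hball⟩ := Metric.mem_nhdsWithin_iff.1 h
  refine ⟨ε, hε, fun s hs hsε hsβ => ?_⟩
  have hslope : m < slope g 0 s := hball
    ⟨by rw [Metric.mem_ball, Real.dist_eq, sub_zero, abs_of_pos hs]; exact hsε,
      ⟨hs.le, hsβ⟩, hs.ne'⟩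
  rw [slope_def_field, hg0, sub_zero, sub_zero, lt_div_iff₀ hs] at hslope
  exact hslope.le

/-- Lemma 5.3.  If `g` is continuous and concave on `[0,β]` with
`g(0) = 0`, `g > 0` on `(0,β)` and (one-sided) derivative `γ > 0` at `0`, then for all
`0 < c < γ` and `0 < b < β` there is `δ* > 0` such that for all `δ ≥ δ*`,
`∫_{b e^{-cδ}}^{b} ds / g(s) ≤ δ`; equivalently, the backward flow of `dq/dt = g(q)`
satisfies `Q_δ⁻¹(b) ≤ b e^{-cδ}`. -/
theorem integral_inv_le_of_concave
    (β γ : ℝ) (hβ : 0 < β) (g : ℝ → ℝ)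
    (hgcont : ContinuousOn g (Set.Icc 0 β))
    (hgconc : ConcaveOn ℝ (Set.Icc 0 β) g)
    (hg0 : g 0 = 0)
    (hgpos : ∀ s ∈ Set.Ioo (0:ℝ) β, 0 < g s)
    (hγ : HasDerivWithinAt g γ (Set.Icc 0 β) 0) (hγpos : 0 < γ) :
    ∀ c : ℝ, 0 < c → c < γ → ∀ b : ℝ, 0 < b → b < β →
      ∃ δstar > (0:ℝ), ∀ δ ≥ δstar,
        (∫ s in (b * Real.exp (-c * δ))..b, (g s)⁻¹) ≤ δ := by
  intro c hc hcγ b hb hbβ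
  obtain ⟨m, hcm, hmγ⟩ := exists_between hcγ
  have hm : 0 < m := hc.trans hcm
  obtain ⟨ε₀, hε₀, hlow⟩ := hγ.exists_forall_mul_le_of_lt hg0 hmγ
  obtain ⟨ε, hε, hεlt⟩ := exists_between (lt_min hε₀ hb)
  have hεb : ε < b := hεlt.trans_le (min_le_right _ _)
  have hint : ∀ x y : ℝ, 0 < x → x ≤ y → y < β →
      IntervalIntegrable (fun s => (g s)⁻¹) volume x y := by
    intro x y hx hxy hy
    apply ContinuousOn.intervalIntegrable
    rw [Set.uIcc_of_le hxy]
    exact (hgcont.mono fun s hs => ⟨hx.le.trans hs.1, hs.2.trans hy.le⟩).inv₀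
      fun s hs => (hgpos s ⟨hx.trans_le hs.1, hs.2.trans_lt hy⟩).ne'
  set M := ∫ s in ε..b, (g s)⁻¹ with hM
  refine ⟨max 1 (max (Real.log (b / ε) / c) (M * m / (m - c))), by positivity,
    fun δ hδ => ?_⟩
  have hδ₁ : Real.log (b / ε) / c ≤ δ := (le_max_left _ _).trans ((le_max_right _ _).trans hδ)
  have hδ₂ : M * m / (m - c) ≤ δ := (le_max_right _ _).trans ((le_max_right _ _).trans hδ)
  rw [div_le_iff₀ hc, Real.log_div hb.ne' hε.ne'] at hδ₁
  rw [div_le_iff₀ (sub_pos.2 hcm)] at hδ₂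
  set a := b * Real.exp (-c * δ) with ha
  have ha₀ : 0 < a := by positivity
  have hloga : Real.log a = Real.log b - c * δ := by
    rw [ha, Real.log_mul hb.ne' (Real.exp_pos _).ne', Real.log_exp]
    ring
  have haε : a ≤ ε := by
    rw [← Real.log_le_log_iff ha₀ hε, hloga]
    linarith
  have hnear : ∫ s in a..ε, (g s)⁻¹ ≤ ∫ s in a..ε, m⁻¹ * s⁻¹ := by
    apply integral_mono_on haε (hint a ε ha₀ haε (hεb.trans hbβ))
    · apply ContinuousOn.intervalIntegrable
      rw [Set.uIcc_of_le haε]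
      exact continuousOn_const.mul
        (continuousOn_id.inv₀ fun s hs => (ha₀.trans_le hs.1).ne')
    · intro s hs
      have hs₀ : 0 < s := ha₀.trans_le hs.1
      rw [← mul_inv]
      exact inv_anti₀ (by positivity) (hlow s hs₀
        (hs.2.trans_lt (hεlt.trans_le (min_le_left _ _)))
        (hs.2.trans (hεb.trans hbβ).le))
  rw [intervalIntegral.integral_const_mul, integral_inv_of_pos ha₀ hε,
    Real.log_div hε.ne' ha₀.ne', hloga] at hnear
  have hlog : Real.log ε ≤ Real.log b := Real.log_le_log hε hεb.le
  have hbound : m⁻¹ * (Real.log ε - (Real.log b - c * δ)) ≤ m⁻¹ * (c * δ) := by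
    gcongr
    linarith
  rw [← integral_add_adjacent_intervals (hint a ε ha₀ haε (hεb.trans hbβ))
    (hint ε b hε hεb.le hbβ), ← hM]
  have hfinal : m⁻¹ * (c * δ) + M ≤ δ := by
    rw [inv_mul_eq_div, div_add' _ _ _ hm.ne', div_le_iff₀ hm]
    linarith
  linarith
end

section
/- Let Λ : ℝ → ℝ be convex with Λ(0) = 0 and differentiable at 0, let γ > 0, and set q := inf_{θ > 0} (Λ(θ) + γ)/θ. If r satisfies Λ'(0) < r < q, then the Legendre transform satisfies Λ̂(r) := sup_{θ ∈ ℝ} [ r θ − Λ(θ) ] < γ. -/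
/-- A convex function on `ℝ` lies above its tangent line at any point of differentiability. -/
theorem ConvexOn.add_deriv_mul_sub_le {f : ℝ → ℝ} (hf : ConvexOn ℝ Set.univ f) {x : ℝ}
    (hx : DifferentiableAt ℝ f x) (y : ℝ) : f x + deriv f x * (y - x) ≤ f y := by
  rcases lt_trichotomy x y with h | rfl | h
  · have hs := hf.deriv_le_slope (Set.mem_univ x) (Set.mem_univ y) h hx
    rw [slope_def_field, le_div_iff₀ (sub_pos.2 h)] at hs
    linarith
  · simp
  · have hs := hf.slope_le_deriv (Set.mem_univ y) (Set.mem_univ x) h hx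
    rw [slope_def_field, div_le_iff₀ (sub_pos.2 h)] at hs
    linarith

/-- convex-analytic core of Lemma 5.4.  If `Λ` is convex with
`Λ(0) = 0`, differentiable at `0`, `γ > 0` and `q = inf_{θ>0} (Λ(θ)+γ)/θ`, then for
`Λ'(0) < r < q` the Legendre transform `Λ̂(r) = sup_θ (rθ - Λ(θ))` is finite and
strictly smaller than `γ`. -/
theorem legendre_lt_of_lt_speed
    (Λ : ℝ → ℝ) (hΛconv : ConvexOn ℝ Set.univ Λ) (hΛ0 : Λ 0 = 0)
    (hΛdiff : DifferentiableAt ℝ Λ 0)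
    (γ : ℝ) (hγ : 0 < γ)
    (q : ℝ) (hq : q = sInf {x : ℝ | ∃ θ > (0:ℝ), x = (Λ θ + γ) / θ})
    (r : ℝ) (hr₁ : deriv Λ 0 < r) (hr₂ : r < q) :
    BddAbove (Set.range fun θ : ℝ => r * θ - Λ θ) ∧
      (⨆ θ : ℝ, (r * θ - Λ θ)) < γ := by
  have htangent (θ : ℝ) : deriv Λ 0 * θ ≤ Λ θ := by
    simpa [hΛ0] using hΛconv.add_deriv_mul_sub_le hΛdiff θ
  have hspeed (θ : ℝ) (hθ : 0 < θ) : q * θ ≤ Λ θ + γ := by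
    rw [← le_div_iff₀ hθ, hq]
    refine csInf_le ⟨deriv Λ 0, ?_⟩ ⟨θ, hθ, rfl⟩
    rintro _ ⟨t, ht, rfl⟩
    rw [le_div_iff₀ ht]
    linarith [htangent t]
  have hqa : 0 < q - deriv Λ 0 := by linarith
  have hbound (θ : ℝ) : r * θ - Λ θ ≤ (r - deriv Λ 0) * γ / (q - deriv Λ 0) := by
    rw [le_div_iff₀ hqa]
    rcases le_or_gt θ 0 with hθ | hθ
    · have hle : r * θ - Λ θ ≤ 0 := by nlinarith [htangent θ]
      exact (mul_nonpos_of_nonpos_of_nonneg hle hqa.le).trans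
        (mul_nonneg (sub_pos.2 hr₁).le hγ.le)
    · linear_combination (q - r) * htangent θ + (r - deriv Λ 0) * hspeed θ hθ
  refine ⟨⟨_, Set.forall_mem_range.2 hbound⟩, (ciSup_le hbound).trans_lt ?_⟩
  rw [div_lt_iff₀ hqa]
  nlinarith
end

section
/- Let Λ : ℝ → ℝ be convex with Λ(0) = 0, and let γ > 0. Define Λ̂(r) := sup_{θ ∈ ℝ} [ rθ − Λ(θ) ] ∈ [0, ∞]. Then inf_{θ > 0} (Λ(θ) + γ)/θ = sup { r ∈ ℝ : Λ̂(r) < γ }; in particular both sides are finite and the set on the right is nonempty and bounded above. -/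
/-- A convex function on `ℝ` vanishing at `0` admits a supporting line at `0`. -/
theorem ConvexOn.exists_mul_le_of_map_zero {Λ : ℝ → ℝ} (hΛ : ConvexOn ℝ Set.univ Λ)
    (hΛ0 : Λ 0 = 0) : ∃ r : ℝ, ∀ θ, r * θ ≤ Λ θ := by
  obtain ⟨r, hr_upper, hr_lower⟩ := exists_between_of_forall_le
    (s := (fun θ => Λ θ / θ) '' Set.Iio 0) (t := (fun θ => Λ θ / θ) '' Set.Ioi 0)
    (Set.nonempty_Iio.image _) (Set.nonempty_Ioi.image _) (by
      rintro _ ⟨a, ha, rfl⟩ _ ⟨b, hb, rfl⟩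
      have h := hΛ.slope_mono_adjacent (Set.mem_univ a) (Set.mem_univ b) ha hb
      simpa [hΛ0, neg_div_neg_eq] using h)
  refine ⟨r, fun θ => ?_⟩
  rcases lt_trichotomy θ 0 with hθ | rfl | hθ
  · exact (div_le_iff_of_neg hθ).1 (hr_upper ⟨θ, hθ, rfl⟩)
  · simp [hΛ0]
  · exact (le_div_iff₀ hθ).1 (hr_lower ⟨θ, hθ, rfl⟩)


/-- alternative formula for the speed.  For `Λ : ℝ → ℝ` convex with
`Λ(0) = 0` and `γ > 0`, with `Λ̂(r) = sup_θ (rθ - Λ(θ)) ∈ [0,∞]` the Legendre transform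
(valued in `EReal`), we have `inf_{θ>0} (Λ(θ)+γ)/θ = sup{r : Λ̂(r) < γ}`; in particular
both sides are finite: the set on the left is bounded below and the set on the right is
nonempty and bounded above. -/
theorem speed_eq_sup_legendre_lt
    (Λ : ℝ → ℝ) (hΛconv : ConvexOn ℝ Set.univ Λ) (hΛ0 : Λ 0 = 0)
    (γ : ℝ) (hγ : 0 < γ) :
    BddBelow {x : ℝ | ∃ θ > (0:ℝ), x = (Λ θ + γ) / θ} ∧
    {r : ℝ | (⨆ θ : ℝ, (↑(r * θ - Λ θ) : EReal)) < (γ : EReal)}.Nonempty ∧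
    BddAbove {r : ℝ | (⨆ θ : ℝ, (↑(r * θ - Λ θ) : EReal)) < (γ : EReal)} ∧
    sInf {x : ℝ | ∃ θ > (0:ℝ), x = (Λ θ + γ) / θ} =
      sSup {r : ℝ | (⨆ θ : ℝ, (↑(r * θ - Λ θ) : EReal)) < (γ : EReal)} := by
  obtain ⟨r₀, hr₀⟩ := hΛconv.exists_mul_le_of_map_zero hΛ0
  set A := {x : ℝ | ∃ θ > (0:ℝ), x = (Λ θ + γ) / θ}
  set S := {r : ℝ | (⨆ θ : ℝ, (↑(r * θ - Λ θ) : EReal)) < (γ : EReal)}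
  have hAne : A.Nonempty := ⟨_, 1, one_pos, rfl⟩
  have hr₀_le : ∀ x ∈ A, r₀ ≤ x := by
    rintro _ ⟨θ, hθ, rfl⟩
    rw [le_div_iff₀ hθ]
    linarith [hr₀ θ]
  have hA : BddBelow A := ⟨r₀, hr₀_le⟩
  have hSA : ∀ r ∈ S, ∀ x ∈ A, r ≤ x := by
    rintro r hr _ ⟨θ, hθ, rfl⟩
    rw [le_div_iff₀ hθ]
    have h := EReal.coe_lt_coe_iff.1
      ((le_iSup (fun θ : ℝ => (↑(r * θ - Λ θ) : EReal)) θ).trans_lt hr)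
    linarith
  set v := sInf A with hv
  have hr₀v : r₀ ≤ v := le_csInf hAne hr₀_le
  have hv_le : ∀ θ, v * θ - Λ θ ≤ γ := by
    intro θ
    rcases le_or_gt θ 0 with hθ | hθ
    · nlinarith [hr₀ θ]
    · have h := csInf_le hA ⟨θ, hθ, rfl⟩
      rw [← hv, le_div_iff₀ hθ] at h
      linarith
  have hS : ∀ t : ℝ, 0 < t → t ≤ 1 → v - t * (v - r₀) ∈ S := by
    intro t ht ht1
    refine lt_of_le_of_lt (b := (((1 - t) * γ : ℝ) : EReal)) (iSup_le fun θ => ?_) ?_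
    · rw [EReal.coe_le_coe_iff]
      nlinarith [mul_le_mul_of_nonneg_left (hv_le θ) (sub_nonneg.2 ht1),
        mul_le_mul_of_nonneg_left (hr₀ θ) ht.le]
    · rw [EReal.coe_lt_coe_iff]
      nlinarith
  have hSne : S.Nonempty := ⟨_, hS 1 one_pos le_rfl⟩
  have hSv : ∀ r ∈ S, r ≤ v := fun r hr => le_csInf hAne (hSA r hr)
  refine ⟨hA, hSne, ⟨v, hSv⟩, (csSup_eq_of_forall_le_of_forall_lt_exists_gt hSne hSv ?_).symm⟩
  intro w hw
  have hd : 0 < (v - r₀) + (v - w) := by linarith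
  refine ⟨_, hS ((v - w) / ((v - r₀) + (v - w))) (div_pos (by linarith) hd)
    ((div_le_one hd).2 (by linarith)), ?_⟩
  have h : (v - w) / ((v - r₀) + (v - w)) * (v - r₀) < v - w := by
    rw [div_mul_eq_mul_div, div_lt_iff₀ hd]
    nlinarith [mul_pos (sub_pos.2 hw) (sub_pos.2 hw)]
  linarith
end

section
/- Let g : ℝ → ℝ be continuous on [0,β] with g(0) = 0, g(s) > 0 for all s ∈ (0,β], and g differentiable at 0 with g'(0) = γ > 0. Let b ∈ (0,β] and c > 0. Then (1/δ) ∫_0^δ b c e^{−cx} / g( b e^{−cx} ) dx → c/γ as δ → ∞. -/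
open Filter intervalIntegral

/-- A function that is continuous on `[0, ∞)` and converges at infinity is bounded there. -/
theorem exists_norm_le_of_continuousOn_Ici_of_tendsto {f : ℝ → ℝ} {l : ℝ}
    (hf : ContinuousOn f (Set.Ici 0)) (hl : Tendsto f atTop (nhds l)) :
    ∃ C, ∀ x, 0 ≤ x → ‖f x‖ ≤ C := by
  obtain ⟨N, hN⟩ := eventually_atTop.1 (hl.norm.eventually_le_const (lt_add_one ‖l‖))
  obtain ⟨C, hC⟩ := (isCompact_Icc (a := (0 : ℝ)) (b := N)).exists_bound_of_continuousOn
    (hf.mono fun x hx => hx.1)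
  refine ⟨max C (‖l‖ + 1), fun x hx => ?_⟩
  rcases le_total x N with h | h
  · exact (hC x ⟨hx, h⟩).trans (le_max_left _ _)
  · exact (hN x h).trans (le_max_right _ _)

/-- Continuous Cesàro theorem: averages over `[0, δ]` converge to the limit at infinity. -/
theorem tendsto_average_integral_of_tendsto {f : ℝ → ℝ} {l : ℝ}
    (hf : ContinuousOn f (Set.Ici 0)) (hl : Tendsto f atTop (nhds l)) :
    Tendsto (fun δ => (1 / δ) * ∫ x in (0 : ℝ)..δ, f x) atTop (nhds l) := by
  obtain ⟨C, hC⟩ := exists_norm_le_of_continuousOn_Ici_of_tendsto hf hl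
  have key : Tendsto (fun δ : ℝ => ∫ t in (0 : ℝ)..1, f (δ * t)) atTop
      (nhds (∫ _ in (0 : ℝ)..1, l)) := by
    refine tendsto_integral_filter_of_dominated_convergence (fun _ => C) ?_ ?_ (by simp) ?_
    · filter_upwards [eventually_ge_atTop 0] with δ hδ
      rw [Set.uIoc_of_le zero_le_one]
      exact (hf.comp (by fun_prop) fun t ht => mul_nonneg hδ ht.1.le).aestronglyMeasurable
        measurableSet_Ioc
    · filter_upwards [eventually_ge_atTop 0] with δ hδ
      refine .of_forall fun t ht => ?_
      rw [Set.uIoc_of_le zero_le_one] at ht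
      exact hC _ (mul_nonneg hδ ht.1.le)
    · refine .of_forall fun t ht => ?_
      rw [Set.uIoc_of_le zero_le_one] at ht
      exact hl.comp (tendsto_id.atTop_mul_const ht.1)
  rw [integral_const, sub_zero, one_smul] at key
  refine key.congr' ?_
  filter_upwards [eventually_gt_atTop 0] with δ hδ
  rw [integral_comp_mul_left f hδ.ne', mul_zero, mul_one, smul_eq_mul, one_div]

/-- the l'Hôpital-type limit in the proof of Lemma 5.3.  If `g` is
continuous on `[0,β]` with `g(0) = 0`, `g > 0` on `(0,β]`, and (one-sided) derivative
`γ > 0` at `0`, then for `b ∈ (0,β]` and `c > 0`,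
`(1/δ) ∫_0^δ b c e^{-cx} / g(b e^{-cx}) dx → c/γ` as `δ → ∞`. -/
theorem average_integral_tendsto_ratio
    (β γ b c : ℝ) (g : ℝ → ℝ)
    (hgcont : ContinuousOn g (Set.Icc 0 β))
    (hg0 : g 0 = 0)
    (hgpos : ∀ s ∈ Set.Ioc (0:ℝ) β, 0 < g s)
    (hγ : HasDerivWithinAt g γ (Set.Icc 0 β) 0) (hγpos : 0 < γ)
    (hb : b ∈ Set.Ioc (0:ℝ) β) (hc : 0 < c) :
    Tendsto (fun δ => (1 / δ) *
        ∫ x in (0:ℝ)..δ, b * c * Real.exp (-c * x) / g (b * Real.exp (-c * x)))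
      atTop (nhds (c / γ)) := by
  have hmem : ∀ x : ℝ, 0 ≤ x → b * Real.exp (-c * x) ∈ Set.Ioc 0 β := fun x hx =>
    ⟨mul_pos hb.1 (Real.exp_pos _), (mul_le_of_le_one_right hb.1.le
      (Real.exp_le_one_iff.2 (by nlinarith))).trans hb.2⟩
  apply tendsto_average_integral_of_tendsto
  · refine ContinuousOn.div (by fun_prop) (hgcont.comp (by fun_prop) fun x hx =>
      Set.Ioc_subset_Icc_self (hmem x hx)) fun x hx => (hgpos _ (hmem x hx)).ne'
  · have hexp : Tendsto (fun x : ℝ => b * Real.exp (-c * x)) atTop (nhds 0) := by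
      simpa using (Real.tendsto_exp_atBot.comp
        (tendsto_id.const_mul_atTop_of_neg (neg_lt_zero.2 hc))).const_mul b
    have hwithin : Tendsto (fun x : ℝ => b * Real.exp (-c * x)) atTop
        (nhdsWithin 0 (Set.Icc 0 β \ {0})) := by
      refine tendsto_nhdsWithin_iff.2 ⟨hexp, ?_⟩
      filter_upwards [eventually_ge_atTop 0] with x hx
      exact ⟨Set.Ioc_subset_Icc_self (hmem x hx), (hmem x hx).1.ne'⟩
    have hslope := (hasDerivWithinAt_iff_tendsto_slope.1 hγ).comp hwithin
    have hquot := (tendsto_const_nhds (x := c)).div hslope hγpos.ne'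
    refine hquot.congr fun x => ?_
    simp only [Pi.div_apply, Function.comp_apply, slope_def_field, hg0, sub_zero,
      div_div_eq_mul_div]
    ring
end
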